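/- Let d, s ≥ 2 be integers with d + s > 5. Then the cone of separable positive semidefinite matrices in Her_d ⊗ Her_s ≅ Her_{ds} (equivalently, under the Choi correspondence, the cone of entanglement-breaking linear maps Mat_d → Mat_s) is not a spectrahedral shadow. -/

import Mathlib

open Matrix
open scoped Kronecker ComplexOrder

/-- A set `S` in a real vector space `V` is a spectrahedral shadow if it is the image,
under a linear map, of a spectrahedron `{x ∈ ℝⁿ | A₀ + x₁A₁ + ⋯ + xₙAₙ ⪰ 0}` described
by Hermitian matrices `A₀, A₁, …, Aₙ`. -/
def IsSpectrahedralShadow {V : Type*} [AddCommGroup V] [Module ℝ V] (S : Set V) : Prop :=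
  ∃ (n m : ℕ) (A₀ : Matrix (Fin m) (Fin m) ℂ) (A : Fin n → Matrix (Fin m) (Fin m) ℂ)
    (L : (Fin n → ℝ) →ₗ[ℝ] V),
    A₀.IsHermitian ∧ (∀ i, (A i).IsHermitian) ∧
      S = L '' {x : Fin n → ℝ | (A₀ + ∑ i, x i • A i).PosSemidef}

/-- `ρ ∈ Her_d ⊗ Her_s` is separable if it is a sum of Kronecker products of positive
semidefinite matrices. -/
def SeparableMat {d s : ℕ} (ρ : Matrix (Fin d × Fin s) (Fin d × Fin s) ℂ) : Prop :=
  ∃ (r : ℕ) (σ : Fin r → Matrix (Fin d) (Fin d) ℂ) (τ : Fin r → Matrix (Fin s) (Fin s) ℂ),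
    (∀ i, (σ i).PosSemidef) ∧ (∀ i, (τ i).PosSemidef) ∧ ρ = ∑ i, σ i ⊗ₖ τ i

/-- A field of characteristic zero is formally smooth over each of its subrings, so lifts through
nilpotent thickenings exist. -/
lemma exists_ringHom_lift_of_injective {B K A : Type*} [CommRing B] [Algebra ℚ B] [Field K]
    [CommRing A] (f : B →+* K) (hf : Function.Injective f) (β : B →+* A) (π : A →+* K)
    (hπ : Function.Surjective π) (hnil : IsNilpotent (RingHom.ker π)) (h : π.comp β = f) :
    ∃ T : K →+* A, T.comp f = β := by
  have : IsDomain B := hf.isDomain f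
  let _ := f.toAlgebra
  let _ := β.toAlgebra
  have : FaithfulSMul B K := (faithfulSMul_iff_algebraMap_injective B K).2 hf
  have : CharZero B := algebraRat.charZero B
  let _ : Algebra (FractionRing B) K := FractionRing.liftAlgebra B K
  have : IsScalarTower B (FractionRing B) K := FractionRing.isScalarTower_liftAlgebra B K
  have : CharZero (FractionRing B) :=
    charZero_of_injective_algebraMap (IsFractionRing.injective B (FractionRing B))
  have : Algebra.FormallySmooth (FractionRing B) K := by
    obtain ⟨ι, x, hx⟩ := exists_isTranscendenceBasis' (FractionRing B) K
    have : Algebra.IsAlgebraic (IntermediateField.adjoin (FractionRing B) (Set.range x)) K :=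
      hx.isAlgebraic_field
    exact .of_algebraicIndependent_of_isSeparable hx.1
  have : Algebra.FormallySmooth B (FractionRing B) := .of_isLocalization (nonZeroDivisors B)
  have : Algebra.FormallySmooth B K := .comp B (FractionRing B) K
  let g : A →ₐ[B] K := { π with commutes' := fun r => RingHom.congr_fun h r }
  let T := Algebra.FormallySmooth.liftOfSurjective (AlgHom.id B K) g hπ hnil
  exact ⟨T.toRingHom, RingHom.ext fun b => T.commutes b⟩

open MvPolynomial in
/-- Formal jets: elements `c` of a ring `R` with a surjection `q` onto a field can be expanded as
polynomials in the coordinates `ξ`, provided that the latter are algebraically independent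
in the field. All polynomial relations persist up to any prescribed order. -/
lemma exists_formal_jet {σ κ R K : Type*} [CommRing R] [Field K]
    (q : R →+* K) (hq : Function.Surjective q) (ι : ℝ →+* R) (ξ : σ → R) (c : κ → R)
    (hf : Function.Injective (eval₂Hom (q.comp ι) fun j => q (ξ j))) (N : ℕ) :
    ∃ t : κ → MvPolynomial σ R, ∀ F : MvPolynomial (σ ⊕ κ) ℝ,
      eval₂Hom ι (Sum.elim ξ c) F = 0 → ∀ α : σ →₀ ℕ, α.degree < N + 1 →
      q (coeff α (eval₂Hom (C.comp ι) (Sum.elim (fun j => X j + C (ξ j)) t) F)) = 0 := by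
  let I : Ideal (MvPolynomial σ K) := idealOfVars σ K ^ (N + 1)
  have hI : I ≤ RingHom.ker (constantCoeff : MvPolynomial σ K →+* K) := by
    intro p hp
    rw [mem_pow_idealOfVars_iff'] at hp
    exact hp 0 (by simp)
  obtain ⟨mkA, hmk⟩ : ∃ m : MvPolynomial σ K →+* MvPolynomial σ K ⧸ I,
    m = Ideal.Quotient.mk I := ⟨_, rfl⟩
  have hmks : Function.Surjective mkA := hmk ▸ Ideal.Quotient.mk_surjective
  obtain ⟨π, hπmk⟩ : ∃ π : MvPolynomial σ K ⧸ I →+* K, ∀ p, π (mkA p) = constantCoeff p :=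
    ⟨Ideal.Quotient.lift I constantCoeff hI, fun p => hmk ▸ Ideal.Quotient.lift_mk I _ hI⟩
  have hmk0 : ∀ p, mkA p = 0 ↔ p ∈ I := fun p => by rw [hmk, Ideal.Quotient.eq_zero_iff_mem]
  have hπ : Function.Surjective π := fun a => ⟨mkA (C a), by simp [hπmk]⟩
  have hnil : IsNilpotent (RingHom.ker π) := by
    refine ⟨N + 1, ?_⟩
    have : RingHom.ker π ≤ (idealOfVars σ K).map mkA := by
      intro a ha
      obtain ⟨p, rfl⟩ := hmks a
      refine Ideal.mem_map_of_mem _ ?_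
      rw [← pow_one (idealOfVars σ K), mem_pow_idealOfVars_iff']
      intro x hx
      have hx0 : x = 0 := by
        simpa [Finsupp.degree_eq_zero_iff] using hx
      subst hx0
      rw [RingHom.mem_ker, hπmk] at ha
      exact ha
    refine le_bot_iff.1 ((Ideal.pow_right_mono this _).trans ?_)
    rw [← Ideal.map_pow, Ideal.map_le_iff_le_comap]
    exact fun p hp => (hmk0 p).2 hp
  obtain ⟨T, hT⟩ := exists_ringHom_lift_of_injective _ hf
    ((mkA.comp (map q)).comp (eval₂Hom (C.comp ι) fun j => X j + C (ξ j))) π hπ hnil (by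
      refine MvPolynomial.ringHom_ext (fun r => ?_) fun j => ?_ <;> simp [hπmk])
  have hlift : ∀ l, ∃ t : MvPolynomial σ R, mkA (map q t) = T (q (c l)) := fun l => by
    obtain ⟨a, ha⟩ := hmks (T (q (c l)))
    obtain ⟨t, rfl⟩ := MvPolynomial.map_surjective q hq a
    exact ⟨t, ha⟩
  choose t ht using hlift
  refine ⟨t, fun F hF α hα => ?_⟩
  have hsub : (mkA.comp (map q)).comp
      (eval₂Hom (C.comp ι) (Sum.elim (fun j => X j + C (ξ j)) t)) =
      (T.comp q).comp (eval₂Hom ι (Sum.elim ξ c)) := by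
    refine MvPolynomial.ringHom_ext (fun r => ?_) ?_
    · have := RingHom.congr_fun hT (C r)
      simp at this
      simp [this]
    · rintro (j | l)
      · have := RingHom.congr_fun hT (X j)
        simp at this
        simp [this]
      · simp [ht]
  have h1 := RingHom.congr_fun hsub F
  rw [RingHom.comp_apply, RingHom.comp_apply, RingHom.comp_apply, hF, map_zero, hmk0,
    mem_pow_idealOfVars_iff'] at h1
  rw [← coeff_map]
  exact h1 α hα

open MvPolynomial in
/-- Polynomial jets, to a prescribed order at a suitable point, of arbitrary functions: all
polynomial relations between the functions and the coordinates survive modulo higher order. -/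
lemma exists_jet {σ κ : Type*} [Finite σ] [Finite κ] (c : κ → (σ → ℝ) → ℝ) (N : ℕ) :
    ∃ (i : σ → ℝ) (τ : κ → MvPolynomial σ ℝ), ∀ F : MvPolynomial (σ ⊕ κ) ℝ,
      (∀ x, eval (Sum.elim x fun l => c l x) F = 0) →
      aeval (Sum.elim (fun j => X j + C (i j)) τ) F ∈ idealOfVars σ ℝ ^ (N + 1) := by
  classical
  let ev : MvPolynomial σ ℝ →+* ((σ → ℝ) → ℝ) := RingHom.pi fun x => eval x
  have hev : Function.Injective ev := fun p q h => MvPolynomial.funext fun x => congrFun h x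
  let S : Submonoid ((σ → ℝ) → ℝ) :=
    Submonoid.map (ev : MvPolynomial σ ℝ →* ((σ → ℝ) → ℝ)) (nonZeroDivisors _)
  obtain ⟨P, hP, -, hPS⟩ := Ideal.exists_le_prime_disjoint (⊥ : Ideal ((σ → ℝ) → ℝ)) S (by
    rw [Set.disjoint_left]
    rintro _ h ⟨p, hp, rfl⟩
    have h0 : ev p = ev 0 := by simpa using h
    exact nonZeroDivisors.ne_zero hp (hev h0))
  have hPf : IsField (((σ → ℝ) → ℝ) ⧸ P) := by
    refine ⟨⟨0, 1, zero_ne_one⟩, mul_comm, fun {a} ha => ?_⟩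
    obtain ⟨f, rfl⟩ := Ideal.Quotient.mk_surjective a
    refine ⟨Ideal.Quotient.mk P f⁻¹, ?_⟩
    have h0 : Ideal.Quotient.mk P f * (Ideal.Quotient.mk P (f * f⁻¹ - 1)) = 0 := by
      rw [← map_mul, show f * (f * f⁻¹ - 1) = 0 from by
        ext x
        by_cases hx : f x = 0 <;> simp [hx], map_zero]
    have := (mul_eq_zero.1 h0).resolve_left ha
    rwa [map_sub, map_one, map_mul, sub_eq_zero] at this
  let ι : ℝ →+* ((σ → ℝ) → ℝ) := Pi.constRingHom _ _
  have hfe : eval₂Hom ((Ideal.Quotient.mk P).comp ι)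
      (fun j : σ => Ideal.Quotient.mk P (fun x => x j)) = (Ideal.Quotient.mk P).comp ev := by
    refine MvPolynomial.ringHom_ext (fun r => ?_) fun j => ?_
    · rw [eval₂Hom_C]
      refine congrArg (Ideal.Quotient.mk P) ?_
      ext x
      simp only [ι, Pi.constRingHom_apply]
      exact (eval_C (f := x) r).symm
    · rw [eval₂Hom_X']
      refine congrArg (Ideal.Quotient.mk P) ?_
      ext x
      exact (eval_X (f := x) j).symm
  obtain ⟨t, ht⟩ := @exists_formal_jet σ κ ((σ → ℝ) → ℝ) (((σ → ℝ) → ℝ) ⧸ P) _ hPf.toField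
    (Ideal.Quotient.mk P)
    Ideal.Quotient.mk_surjective ι (fun j x => x j) c (by
      change Function.Injective (eval₂Hom ((Ideal.Quotient.mk P).comp ι)
        (fun j : σ => Ideal.Quotient.mk P (fun x => x j)))
      rw [hfe, injective_iff_map_eq_zero]
      intro p hp
      by_contra hne
      exact Set.disjoint_left.1 hPS (Ideal.Quotient.eq_zero_iff_mem.1 hp)
        ⟨p, mem_nonZeroDivisors_of_ne_zero hne, rfl⟩) N
  let rel : MvPolynomial (σ ⊕ κ) ℝ →+* ((σ → ℝ) → ℝ) := eval₂Hom ι (Sum.elim (fun j x => x j) c)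
  let sub : MvPolynomial (σ ⊕ κ) ℝ →+* MvPolynomial σ ((σ → ℝ) → ℝ) :=
    eval₂Hom (C.comp ι) (Sum.elim (fun j => X j + C (fun x => x j)) t)
  have hcoeff : ∀ F ∈ RingHom.ker rel, ∀ α, α.degree < N + 1 → (sub F).coeff α ∈ P :=
    fun F hF α hα => Ideal.Quotient.eq_zero_iff_mem.1 (ht F hF α hα)
  obtain ⟨s, hs⟩ := (isNoetherianRing_iff_ideal_fg _).1
    (inferInstance : IsNoetherianRing (MvPolynomial (σ ⊕ κ) ℝ)) (RingHom.ker rel)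
  have hfin : {α : σ →₀ ℕ | α.degree < N + 1}.Finite := by
    simpa [Nat.lt_succ_iff] using Finsupp.finite_of_degree_le (σ := σ) N
  let Γ := hfin.toFinset
  obtain ⟨i, hi⟩ : ∃ i, ∀ F ∈ s, ∀ α ∈ Γ, (sub F).coeff α i = 0 := by
    by_contra! hcon
    let u : ((σ → ℝ) → ℝ) := ∑ F ∈ s, ∑ α ∈ Γ, (sub F).coeff α * (sub F).coeff α
    have hu : u ∈ P := Ideal.sum_mem _ fun F hF => Ideal.sum_mem _ fun α hα =>
      P.mul_mem_left _ (hcoeff F (hs ▸ Ideal.subset_span hF) α (by simpa [Γ] using hα))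
    have hunit : IsUnit u := by
      rw [Pi.isUnit_iff]
      intro x
      obtain ⟨F, hF, α, hα, hne⟩ := hcon x
      refine (ne_of_gt ?_).isUnit
      simp only [u, Finset.sum_apply, Pi.mul_apply]
      refine Finset.sum_pos' (fun _ _ => Finset.sum_nonneg fun _ _ => mul_self_nonneg _)
        ⟨F, hF, Finset.sum_pos' (fun _ _ => mul_self_nonneg _) ⟨α, hα, ?_⟩⟩
      exact mul_self_pos.2 hne
    exact hP.ne_top (Ideal.eq_top_of_isUnit_mem _ hu hunit)
  let evi : ((σ → ℝ) → ℝ) →+* ℝ := Pi.evalRingHom _ i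
  refine ⟨i, fun l => map evi (t l), fun F hF => ?_⟩
  have hFk : F ∈ RingHom.ker rel := by
    rw [RingHom.mem_ker]
    ext x
    rw [Pi.zero_apply, ← hF x]
    have : (Pi.evalRingHom (fun _ : σ → ℝ => ℝ) x).comp rel
        = (eval (Sum.elim x fun l => c l x)) := by
      refine MvPolynomial.ringHom_ext (fun r => by simp [rel, ι]) ?_
      rintro (j | l) <;> simp [rel]
    exact RingHom.congr_fun this F
  have hcomp : (map evi).comp sub =
      (aeval (Sum.elim (fun j => X j + C (i j)) fun l => map evi (t l)) :
        MvPolynomial (σ ⊕ κ) ℝ →ₐ[ℝ] MvPolynomial σ ℝ).toRingHom := by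
    refine MvPolynomial.ringHom_ext (fun r => by simp [sub, ι, evi]) ?_
    rintro (j | l)
    · have : evi (fun x => x j) = i j := rfl
      simp [sub, this]
    · simp [sub]
  have hFs : RingHom.ker rel ≤ (idealOfVars σ ℝ ^ (N + 1)).comap ((map evi).comp sub) := by
    rw [← hs, Ideal.span_le]
    intro G hG
    rw [SetLike.mem_coe, Ideal.mem_comap]
    refine (mem_pow_idealOfVars_iff' _ _).2 fun α hα => ?_
    simpa [coeff_map, evi] using hi G hG α (by simpa [Γ] using hα)
  have := hFs hFk
  rw [Ideal.mem_comap, hcomp] at this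
  exact this
open Filter Topology in
/-- Positive definiteness of a quadratic form is stable under continuous perturbation. -/
lemma eventually_pos_quadraticForm {ι : Type*} (Γ : Finset ι) (A : ℝ → ι → ι → ℝ)
    (hA : ∀ β γ, Continuous fun ε => A ε β γ)
    (h0 : ∀ G : ι → ℝ, (∃ β ∈ Γ, G β ≠ 0) → 0 < ∑ β ∈ Γ, ∑ γ ∈ Γ, G β * G γ * A 0 β γ) :
    ∀ᶠ ε in 𝓝 0, ∀ G : ι → ℝ, (∃ β ∈ Γ, G β ≠ 0) →
      0 < ∑ β ∈ Γ, ∑ γ ∈ Γ, G β * G γ * A ε β γ := by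
  let Q : ℝ → (Γ → ℝ) → ℝ := fun ε K => ∑ β, ∑ γ, K β * K γ * A ε β γ
  have hQG : ∀ ε (G : ι → ℝ),
      Q ε (fun β => G β) = ∑ β ∈ Γ, ∑ γ ∈ Γ, G β * G γ * A ε β γ := by
    intro ε G
    rw [← Finset.sum_coe_sort Γ]
    refine Finset.sum_congr rfl fun β _ => ?_
    rw [← Finset.sum_coe_sort Γ]
  have hQ : Continuous fun q : ℝ × (Γ → ℝ) => Q q.1 q.2 := by
    refine continuous_finsetSum _ fun β _ => continuous_finsetSum _ fun γ _ => ?_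
    have := (hA β γ).comp (continuous_fst (X := ℝ) (Y := Γ → ℝ))
    fun_prop
  have hext : ∀ K : Γ → ℝ, ∃ G : ι → ℝ, K = fun β : Γ => G β := by
    classical
    exact fun K => ⟨fun i => if h : i ∈ Γ then K ⟨i, h⟩ else 0, by ext β; simp⟩
  have hpos : ∀ K : Γ → ℝ, K ≠ 0 → 0 < Q 0 K := by
    intro K hK
    obtain ⟨G, rfl⟩ := hext K
    obtain ⟨β, hβ⟩ := Function.ne_iff.1 hK
    rw [hQG]
    exact h0 G ⟨β, β.2, hβ⟩
  have hsph : ∀ᶠ ε in 𝓝 (0 : ℝ), ∀ K ∈ Metric.sphere (0 : Γ → ℝ) 1, 0 < Q ε K := by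
    refine (isCompact_sphere _ _).eventually_forall_of_forall_eventually fun K hK => ?_
    refine hQ.continuousAt.eventually (lt_mem_nhds ?_)
    exact hpos K (ne_zero_of_mem_unit_sphere ⟨K, hK⟩)
  filter_upwards [hsph] with ε hε G ⟨β, hβ, hne⟩
  rw [← hQG]
  set K : Γ → ℝ := fun β => G β
  have hK : K ≠ 0 := fun h => hne (congrFun h ⟨β, hβ⟩)
  have hn : 0 < ‖K‖ := norm_pos_iff.2 hK
  have h1 := hε (‖K‖⁻¹ • K) (by simp [norm_smul, hn.ne'])
  have h2 : Q ε K = ‖K‖ ^ 2 * Q ε (‖K‖⁻¹ • K) := by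
    simp only [Q, Finset.mul_sum]
    refine Finset.sum_congr rfl fun β _ => Finset.sum_congr rfl fun γ _ => ?_
    simp only [Pi.smul_apply, smul_eq_mul]
    field_simp
  rw [h2]
  positivity

/-- The moment matrix of `m` indexed by the finite set `Γ` of exponents is positive definite. -/
def MomentPosOn {σ : Type*} (m : (σ →₀ ℕ) → ℝ) (Γ : Finset (σ →₀ ℕ)) : Prop :=
  ∀ G : (σ →₀ ℕ) → ℝ, (∃ β ∈ Γ, G β ≠ 0) → 0 < ∑ β ∈ Γ, ∑ γ ∈ Γ, G β * G γ * m (β + γ)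

lemma MomentPosOn.mono {σ : Type*} {m : (σ →₀ ℕ) → ℝ} {Γ Γ' : Finset (σ →₀ ℕ)}
    (h : MomentPosOn m Γ) (hΓ : Γ' ⊆ Γ) : MomentPosOn m Γ' := by
  classical
  intro G ⟨β, hβ, hne⟩
  have := h (fun β => if β ∈ Γ' then G β else 0) ⟨β, hΓ hβ, by simpa [hβ] using hne⟩
  simpa [Finset.sum_ite, ite_mul, mul_ite, ← Finset.sum_filter, Finset.filter_mem_eq_inter,
    Finset.inter_eq_right.2 hΓ] using this

open MvPolynomial in
/-- A measure on a sufficiently large grid has positive definite moment matrix. -/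
lemma exists_momentPosOn {σ : Type*} [Finite σ] (Γ : Finset (σ →₀ ℕ)) :
    ∃ m, MomentPosOn m Γ := by
  classical
  have := Fintype.ofFinite σ
  let d := Γ.sup fun α => α.degree
  let S : σ → Finset ℝ := fun _ => (Finset.range (d + 1)).map Nat.castEmbedding
  refine ⟨fun α => ∑ x ∈ Fintype.piFinset S, eval x (monomial α 1), fun G ⟨β, hβ, hne⟩ => ?_⟩
  let P : MvPolynomial σ ℝ := ∑ β ∈ Γ, monomial β (G β)
  have hP : coeff β P = G β := by
    simp [P, coeff_sum, coeff_monomial, hβ]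
  have hsum : ∑ β ∈ Γ, ∑ γ ∈ Γ, G β * G γ * ∑ x ∈ Fintype.piFinset S,
      eval x (monomial (β + γ) 1) = ∑ x ∈ Fintype.piFinset S, (eval x P) ^ 2 := by
    simp only [Finset.mul_sum, P, map_sum, sq, Finset.sum_mul]
    symm
    rw [Finset.sum_comm]
    refine Finset.sum_congr rfl fun β _ => ?_
    rw [Finset.sum_comm]
    refine Finset.sum_congr rfl fun γ _ => Finset.sum_congr rfl fun x _ => ?_
    rw [← map_mul, monomial_mul, add_comm γ, ← mul_one (G γ * G β), ← smul_eq_mul,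
      ← smul_monomial, smul_eval, mul_comm (G γ)]
  rw [hsum]
  refine lt_of_le_of_ne (Finset.sum_nonneg fun _ _ => sq_nonneg _) fun h => hne ?_
  have hz := (Finset.sum_eq_zero_iff_of_nonneg fun _ _ => sq_nonneg _).1 h.symm
  rw [← hP, eq_zero_of_eval_zero_at_prod_finset P S (fun i => ?_) fun x hx => ?_]
  · simp
  · simp only [S, Finset.card_map, Finset.card_range, Nat.lt_succ_iff]
    refine (degreeOf_le_totalDegree P i).trans ?_
    refine totalDegree_finsetSum_le fun β hβ => (totalDegree_monomial_le _ _).trans ?_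
    exact Finset.le_sup (f := fun α : σ →₀ ℕ => α.degree) hβ
  · exact pow_eq_zero_iff two_ne_zero |>.1 (hz x (by simpa using hx))

open Filter Topology in
/-- Truncated moments, supported on the exponents of weight at most `2 * D`, extend to larger sets
of exponents with small distortion. -/
lemma MomentPosOn.exists_extend {σ : Type*} [Finite σ] (w : (σ →₀ ℕ) → ℕ)
    (hw : ∀ α β, w (α + β) = w α + w β) (D : ℕ) (Γ : Finset (σ →₀ ℕ)) (m : (σ →₀ ℕ) → ℝ)
    (hm : MomentPosOn m (Γ.filter fun α => w α ≤ D)) (p : MvPolynomial σ ℝ)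
    (hp : ∀ α ∈ p.support, w α ≤ 2 * D) (hneg : ∑ α ∈ p.support, p.coeff α * m α < 0) :
    ∃ m', MomentPosOn m' Γ ∧ ∑ α ∈ p.support, p.coeff α * m' α < 0 := by
  classical
  obtain ⟨mI, hI⟩ := exists_momentPosOn Γ
  let e : (σ →₀ ℕ) → ℕ := fun β => if w β ≤ D then 0 else 2 * w β - (2 * D + 1)
  let e' : (σ →₀ ℕ) → ℕ := fun β => 2 * D + 1 - 2 * w β
  let A : ℝ → (σ →₀ ℕ) → (σ →₀ ℕ) → ℝ := fun θ β γ =>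
    (if w (β + γ) ≤ 2 * D then θ ^ (e β + e γ) * m (β + γ) else 0) +
      θ ^ (e' β + e' γ) * mI (β + γ)
  have hA : ∀ β γ, Continuous fun θ => A θ β γ := by
    intro β γ
    by_cases h : w (β + γ) ≤ 2 * D <;> simp only [A, h, if_true, if_false] <;> fun_prop
  have hA0 : ∀ β γ, A 0 β γ = (if w β ≤ D ∧ w γ ≤ D then m (β + γ) else 0) +
      (if ¬ w β ≤ D ∧ ¬ w γ ≤ D then mI (β + γ) else 0) := by
    intro β γ
    have h1 := hw β γ
    by_cases hβ : w β ≤ D <;> by_cases hγ : w γ ≤ D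
    · have : w (β + γ) ≤ 2 * D := by lia
      have h2 : e' β + e' γ ≠ 0 := by simp only [e']; lia
      simp [A, e, hβ, hγ, this, zero_pow h2]
    · have h2 : e' β + e' γ ≠ 0 := by simp only [e']; lia
      have h3 : e β + e γ ≠ 0 := by simp only [e, hβ, hγ, if_true, if_false]; lia
      simp [A, hβ, hγ, zero_pow h2, zero_pow h3]
    · have h2 : e' β + e' γ ≠ 0 := by simp only [e']; lia
      have h3 : e β + e γ ≠ 0 := by simp only [e, hβ, hγ, if_true, if_false]; lia
      simp [A, hβ, hγ, zero_pow h2, zero_pow h3]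
    · have h2 : e' β + e' γ = 0 := by simp only [e']; lia
      have h3 : e β + e γ ≠ 0 := by simp only [e, hβ, hγ, if_false]; lia
      simp [A, hβ, hγ, h2, zero_pow h3]
  have hpos := eventually_pos_quadraticForm Γ A hA (by
    intro G ⟨β, hβ, hne⟩
    have hsplit : ∑ β ∈ Γ, ∑ γ ∈ Γ, G β * G γ * A 0 β γ =
        (∑ β ∈ Γ.filter (fun α => w α ≤ D), ∑ γ ∈ Γ.filter (fun α => w α ≤ D),
          G β * G γ * m (β + γ)) +
        ∑ β ∈ Γ.filter (fun α => ¬ w α ≤ D), ∑ γ ∈ Γ.filter (fun α => ¬ w α ≤ D),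
          G β * G γ * mI (β + γ) := by
      simp only [hA0, mul_add, Finset.sum_add_distrib, Finset.sum_filter, mul_ite, mul_zero,
        ite_and]
      congr 1
      · refine Finset.sum_congr rfl fun β _ => ?_
        by_cases h : w β ≤ D <;> simp [h]
      · refine Finset.sum_congr rfl fun β _ => ?_
        by_cases h : w β ≤ D <;> simp [h]
    rw [hsplit]
    have hI' := hI.mono (Finset.filter_subset (fun α => ¬ w α ≤ D) Γ)
    have nonneg : ∀ {m : (σ →₀ ℕ) → ℝ} {Γ : Finset (σ →₀ ℕ)}, MomentPosOn m Γ →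
        0 ≤ ∑ β ∈ Γ, ∑ γ ∈ Γ, G β * G γ * m (β + γ) := by
      intro m Γ h
      by_cases hG : ∃ β ∈ Γ, G β ≠ 0
      · exact (h G hG).le
      · push Not at hG
        refine (Finset.sum_eq_zero fun β hβ => ?_).ge
        simp [hG β hβ]
    by_cases h : w β ≤ D
    · exact add_pos_of_pos_of_nonneg (hm G ⟨β, by simp [hβ, h], hne⟩) (nonneg hI')
    · exact add_pos_of_nonneg_of_pos (nonneg hm)
        (hI' G ⟨β, by simp [hβ] ; lia, hne⟩))
  let M : ℝ → ℝ := fun θ => ∑ α ∈ p.support,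
    p.coeff α * (m α + θ ^ (4 * D + 2 - 2 * w α) * mI α)
  have hM : ∀ᶠ θ in 𝓝 0, M θ < 0 := by
    have hc : Continuous M := by fun_prop
    refine hc.continuousAt.eventually (gt_mem_nhds ?_)
    refine lt_of_eq_of_lt (Finset.sum_congr rfl fun α hα => ?_) hneg
    have := hp α hα
    simp [zero_pow (show 4 * D + 2 - 2 * w α ≠ 0 by lia)]
  obtain ⟨θ, ⟨h1, h2⟩, hθ⟩ := (((hpos.and hM).filter_mono nhdsWithin_le_nhds).and
    (self_mem_nhdsWithin : Set.Ioi (0 : ℝ) ∈ 𝓝[>] 0)).exists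
  have hθ : 0 < θ := hθ
  refine ⟨fun α => (if w α ≤ 2 * D then m α else 0) + θ ^ (4 * D + 2) / θ ^ (2 * w α) * mI α,
    fun G ⟨β, hβ, hne⟩ => ?_, ?_⟩
  · refine lt_of_lt_of_eq (h1 (fun β => G β / θ ^ e β) ⟨β, hβ, by positivity⟩) ?_
    refine Finset.sum_congr rfl fun β _ => Finset.sum_congr rfl fun γ _ => ?_
    have key : ∀ β, θ ^ e β * θ ^ (2 * D + 1) = θ ^ e' β * θ ^ (2 * w β) := by
      intro β
      rw [← pow_add, ← pow_add]
      congr 1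
      by_cases h : w β ≤ D <;> simp only [e, e', h, if_true, if_false] <;> lia
    have hk : θ ^ (4 * D + 2) / θ ^ (2 * w (β + γ)) =
        θ ^ (e' β + e' γ) / (θ ^ e β * θ ^ e γ) := by
      have k1 := key β
      have k2 := key γ
      rw [div_eq_div_iff (by positivity) (by positivity), hw, pow_add θ (e' β),
        show 4 * D + 2 = (2 * D + 1) + (2 * D + 1) by ring, pow_add, mul_add, pow_add]
      linear_combination θ ^ e γ * θ ^ (2 * D + 1) * k1 + θ ^ e' β * θ ^ (2 * w β) * k2
    beta_reduce
    rw [hk]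
    by_cases h : w (β + γ) ≤ 2 * D
    · simp only [A, h, if_true, pow_add]
      field_simp
    · simp only [A, h, if_false, pow_add]
      field_simp
      ring
  · refine lt_of_eq_of_lt (Finset.sum_congr rfl fun α hα => ?_) h2
    have := hp α hα
    beta_reduce
    rw [if_pos this, pow_sub₀ θ hθ.ne' (by lia)]
    rfl

/-- The exponents of degree at most `r`. -/
noncomputable def exponentsLE (σ : Type*) [Finite σ] (r : ℕ) : Finset (σ →₀ ℕ) :=
  (Finsupp.finite_of_degree_le (σ := σ) r).toFinset

@[simp]
lemma mem_exponentsLE {σ : Type*} [Finite σ] {r : ℕ} {α : σ →₀ ℕ} :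
    α ∈ exponentsLE σ r ↔ α.degree ≤ r := by
  simp [exponentsLE]

/-- The functional on polynomials given by the moments `m`, scaled by `ε` and truncated
at degree `r`. -/
noncomputable def truncMoment {σ : Type*} (m : (σ →₀ ℕ) → ℝ) (r : ℕ) (ε : ℝ) :
    MvPolynomial σ ℝ →ₗ[ℝ] ℝ :=
  (MvPolynomial.basisMonomials σ ℝ).constr ℝ fun α =>
    if α.degree ≤ r then ε ^ α.degree * m α else 0

open MvPolynomial in
lemma truncMoment_monomial {σ : Type*} (m : (σ →₀ ℕ) → ℝ) (r : ℕ) (ε : ℝ) (α : σ →₀ ℕ)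
    (a : ℝ) : truncMoment m r ε (monomial α a) =
      a * if α.degree ≤ r then ε ^ α.degree * m α else 0 := by
  have : monomial α a = a • basisMonomials σ ℝ α := by
    simp [smul_monomial]
  rw [this, map_smul, truncMoment, Module.Basis.constr_basis, smul_eq_mul]

open MvPolynomial in
lemma truncMoment_mul_self {σ : Type*} [Finite σ] (m : (σ →₀ ℕ) → ℝ) (r : ℕ) (ε : ℝ)
    (f : MvPolynomial σ ℝ) : truncMoment m r ε (f * f) =
      ∑ β ∈ exponentsLE σ r, ∑ γ ∈ exponentsLE σ r, f.coeff β * f.coeff γ *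
        if (β + γ).degree ≤ r then ε ^ (β + γ).degree * m (β + γ) else 0 := by
  classical
  set s : Finset (σ →₀ ℕ) := f.support ∪ exponentsLE σ r
  have hf : f = ∑ β ∈ s, monomial β (f.coeff β) := by
    conv_lhs => rw [f.as_sum]
    refine Finset.sum_subset Finset.subset_union_left fun β _ hβ => ?_
    simp [notMem_support_iff.1 hβ]
  have h1 : truncMoment m r ε (f * f) = ∑ β ∈ s, ∑ γ ∈ s, f.coeff β * f.coeff γ *
      if (β + γ).degree ≤ r then ε ^ (β + γ).degree * m (β + γ) else 0 := by
    conv_lhs => rw [hf]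
    simp only [Finset.sum_mul_sum, map_sum, monomial_mul, truncMoment_monomial]
  rw [h1]
  have hz : ∀ β γ : σ →₀ ℕ, β ∉ exponentsLE σ r ∨ γ ∉ exponentsLE σ r →
      ¬ (β + γ).degree ≤ r := by
    intro β γ h
    simp only [mem_exponentsLE, map_add] at h ⊢
    lia
  symm
  refine Finset.sum_subset_zero_on_sdiff Finset.subset_union_right (fun β hβ => ?_) fun β _ => ?_
  · refine Finset.sum_eq_zero fun γ _ => ?_
    rw [if_neg (hz β γ (.inl (Finset.mem_sdiff.1 hβ).2)), mul_zero]
  · refine Finset.sum_subset Finset.subset_union_right fun γ _ hγ => ?_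
    rw [if_neg (hz β γ (.inr hγ)), mul_zero]

open MvPolynomial Filter Topology in
/-- If the coefficients up to degree `2 * r` of the polynomials in `V₀` are determined by those up
to degree `r`, then scaled positive definite moments are nonnegative on squares from `V₀`. -/
lemma eventually_truncMoment_mul_self_nonneg {σ : Type*} [Finite σ] (m : (σ →₀ ℕ) → ℝ) (r : ℕ)
    (hm : MomentPosOn m (exponentsLE σ r)) (V₀ : Submodule ℝ (MvPolynomial σ ℝ))
    (hV : ∀ f ∈ V₀, (∀ α : σ →₀ ℕ, α.degree ≤ r → f.coeff α = 0) →
      ∀ α : σ →₀ ℕ, α.degree ≤ 2 * r → f.coeff α = 0) :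
    ∀ᶠ ε in 𝓝[>] 0, ∀ f ∈ V₀, 0 ≤ truncMoment m (2 * r) ε (f * f) := by
  classical
  obtain ⟨H, hH, hHd⟩ : ∃ H : (σ →₀ ℕ) → (σ →₀ ℕ) → ℝ,
      (∀ f ∈ V₀, ∀ α ∈ exponentsLE σ (2 * r),
        f.coeff α = ∑ β ∈ exponentsLE σ r, H α β * f.coeff β) ∧
      ∀ α ∈ exponentsLE σ r, ∀ β, H α β = if α = β then 1 else 0 := by
    have : ∀ α, ∃ h : (σ →₀ ℕ) → ℝ, (∀ f ∈ V₀, α ∈ exponentsLE σ (2 * r) →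
        f.coeff α = ∑ β ∈ exponentsLE σ r, h β * f.coeff β) ∧
        (α ∈ exponentsLE σ r → ∀ β, h β = if α = β then 1 else 0) := by
      intro α
      by_cases hα : α ∈ exponentsLE σ r
      · exact ⟨fun β => if α = β then 1 else 0, fun f _ _ => by simp [hα], fun _ _ => rfl⟩
      by_cases hα2 : α ∈ exponentsLE σ (2 * r)
      swap
      · exact ⟨0, fun f _ h => absurd h hα2, fun h => absurd h hα⟩
      have hmem := mem_span_of_iInf_ker_le_ker
        (L := fun β : exponentsLE σ r => (lcoeff ℝ (β : σ →₀ ℕ)).domRestrict V₀)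
        (K := (lcoeff ℝ α).domRestrict V₀) (by
          intro f hf
          simp only [Submodule.mem_iInf, LinearMap.mem_ker, LinearMap.domRestrict_apply,
            lcoeff_apply] at hf ⊢
          exact hV f f.2 (fun β hβ => hf ⟨β, mem_exponentsLE.2 hβ⟩) α (mem_exponentsLE.1 hα2))
      obtain ⟨c, hc⟩ := (Submodule.mem_span_range_iff_exists_fun ℝ).1 hmem
      refine ⟨fun β => if h : β ∈ exponentsLE σ r then c ⟨β, h⟩ else 0,
        fun f hf _ => ?_, fun h => absurd h hα⟩
      have := LinearMap.congr_fun hc ⟨f, hf⟩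
      rw [← Finset.sum_coe_sort]
      simpa using this.symm
    choose H h1 h2 using this
    exact ⟨H, fun f hf α hα => h1 α f hf hα, h2⟩
  let A : ℝ → (σ →₀ ℕ) → (σ →₀ ℕ) → ℝ := fun ε b c =>
    ∑ β ∈ exponentsLE σ (2 * r), ∑ γ ∈ exponentsLE σ (2 * r), H β b * H γ c *
      (ε ^ ((β.degree - b.degree) + (γ.degree - c.degree)) *
        if (β + γ).degree ≤ 2 * r then m (β + γ) else 0)
  have hA : ∀ b c, Continuous fun ε => A ε b c := fun b c => by fun_prop
  have hsub : exponentsLE σ r ⊆ exponentsLE σ (2 * r) := fun α hα => by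
    rw [mem_exponentsLE] at hα ⊢
    lia
  have hA0 : ∀ b ∈ exponentsLE σ r, ∀ c ∈ exponentsLE σ r, A 0 b c = m (b + c) := by
    intro b hb c hc
    simp only [A]
    have hz : ∀ a ∈ exponentsLE σ r, ∀ β, β ≠ a → H β a = 0 ∨ β.degree - a.degree ≠ 0 := by
      intro a ha β hne
      by_cases hβ : β ∈ exponentsLE σ r
      · exact .inl (by rw [hHd β hβ, if_neg hne])
      · rw [mem_exponentsLE] at ha hβ
        exact .inr (by lia)
    rw [Finset.sum_eq_single_of_mem b (hsub hb), Finset.sum_eq_single_of_mem c (hsub hc)]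
    · rw [mem_exponentsLE] at hb hc
      have : (b + c).degree ≤ 2 * r := by rw [map_add]; lia
      rw [if_pos this]
      simp [hHd, hb, hc]
    · intro γ _ hne
      rcases hz c hc γ hne with h | h
      · simp [h]
      · rw [zero_pow (by lia), zero_mul, mul_zero]
    · intro β _ hne
      refine Finset.sum_eq_zero fun γ _ => ?_
      rcases hz b hb β hne with h | h
      · simp [h]
      · rw [zero_pow (by lia), zero_mul, mul_zero]
  have hev := eventually_pos_quadraticForm (exponentsLE σ r) A hA fun G hG => by
    refine lt_of_lt_of_eq (hm G hG) ?_
    refine Finset.sum_congr rfl fun b hb => Finset.sum_congr rfl fun c hc => ?_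
    rw [hA0 b hb c hc]
  filter_upwards [nhdsWithin_le_nhds hev, self_mem_nhdsWithin] with ε hε hpos f hf
  have hexp : ∀ a ∈ exponentsLE σ r, ∀ β,
      H β a * ε ^ β.degree = ε ^ a.degree * (H β a * ε ^ (β.degree - a.degree)) := by
    intro a ha β
    by_cases hβ : β ∈ exponentsLE σ r
    · rw [hHd β hβ]
      by_cases h : β = a <;> simp [h]
    · rw [mem_exponentsLE] at ha hβ
      rw [mul_left_comm, ← pow_add, Nat.add_sub_cancel' (by lia)]
  have hform : truncMoment m (2 * r) ε (f * f) =
      ∑ b ∈ exponentsLE σ r, ∑ c ∈ exponentsLE σ r,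
        (ε ^ b.degree * f.coeff b) * (ε ^ c.degree * f.coeff c) * A ε b c := by
    rw [truncMoment_mul_self]
    have : ∀ β ∈ exponentsLE σ (2 * r), ∀ γ ∈ exponentsLE σ (2 * r),
        (f.coeff β * f.coeff γ *
          if (β + γ).degree ≤ 2 * r then ε ^ (β + γ).degree * m (β + γ) else 0) =
        ∑ b ∈ exponentsLE σ r, ∑ c ∈ exponentsLE σ r,
          (ε ^ b.degree * f.coeff b) * (ε ^ c.degree * f.coeff c) * (H β b * H γ c *
      (ε ^ ((β.degree - b.degree) + (γ.degree - c.degree)) *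
        if (β + γ).degree ≤ 2 * r then m (β + γ) else 0)) := by
      intro β hβ γ hγ
      rw [hH f hf β hβ, hH f hf γ hγ, Finset.sum_mul_sum, Finset.sum_mul]
      refine Finset.sum_congr rfl fun b hb => ?_
      rw [Finset.sum_mul]
      refine Finset.sum_congr rfl fun c hc => ?_
      have k1 := hexp b hb β
      have k2 := hexp c hc γ
      by_cases h : (β + γ).degree ≤ 2 * r
      · rw [if_pos h, if_pos h, map_add, pow_add, pow_add]
        linear_combination f.coeff b * f.coeff c * m (β + γ) * (H γ c * ε ^ γ.degree * k1 +
          ε ^ b.degree * (H β b * ε ^ (β.degree - b.degree)) * k2)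
      · rw [if_neg h, if_neg h]
        simp only [mul_zero]
    rw [Finset.sum_congr rfl fun β hβ => Finset.sum_congr rfl fun γ hγ => this β hβ γ hγ]
    simp only [A, Finset.mul_sum]
    rw [Finset.sum_congr rfl fun β hβ => Finset.sum_comm]
    rw [Finset.sum_comm]
    refine Finset.sum_congr rfl fun b _ => ?_
    rw [Finset.sum_congr rfl fun β hβ => Finset.sum_comm]
    rw [Finset.sum_comm]
  rw [hform]
  by_cases hG : ∃ b ∈ exponentsLE σ r, ε ^ b.degree * f.coeff b ≠ 0
  · exact (hε _ hG).le
  · push Not at hG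
    refine (Finset.sum_eq_zero fun b hb => ?_).ge
    simp [hG b hb]

open MvPolynomial in
/-- In a finite-dimensional space of polynomials, at some degree on a dyadic scale no new
conditions appear when passing to the double of the degree. -/
lemma exists_degree_gap {σ : Type*} (V₀ : Submodule ℝ (MvPolynomial σ ℝ))
    [FiniteDimensional ℝ V₀] (D : ℕ) : ∃ k ≤ Module.finrank ℝ V₀,
      ∀ f ∈ V₀, (∀ α : σ →₀ ℕ, α.degree ≤ D * 2 ^ k → f.coeff α = 0) →
        ∀ α : σ →₀ ℕ, α.degree ≤ 2 * (D * 2 ^ k) → f.coeff α = 0 := by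
  let W : ℕ → Submodule ℝ V₀ := fun k =>
    { carrier := {f | ∀ α : σ →₀ ℕ, α.degree ≤ D * 2 ^ k → (f : MvPolynomial σ ℝ).coeff α = 0}
      add_mem' := fun {f g} hf hg α hα => by simp [hf α hα, hg α hα]
      zero_mem' := fun α _ => by simp
      smul_mem' := fun c f hf α hα => by simp [hf α hα] }
  have hW : ∀ k, W (k + 1) ≤ W k := fun k f hf α hα => hf α (hα.trans (by
    rw [pow_succ]; nlinarith [Nat.zero_le (D * 2 ^ k)]))
  by_contra! hcon
  have hlt : ∀ k ≤ Module.finrank ℝ V₀,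
      Module.finrank ℝ (W (k + 1)) < Module.finrank ℝ (W k) := by
    intro k hk
    refine Submodule.finrank_lt_finrank_of_lt (lt_of_le_of_ne (hW k) fun h => ?_)
    obtain ⟨f, hf, h0, α, hα, hne⟩ := hcon k hk
    have h1 : (⟨f, hf⟩ : V₀) ∈ W k := h0
    rw [← h] at h1
    exact hne (h1 α (by rw [pow_succ]; lia))
  have hsum : ∀ k ≤ Module.finrank ℝ V₀ + 1,
      Module.finrank ℝ (W k) + k ≤ Module.finrank ℝ V₀ := by
    intro k
    induction k with
    | zero => exact fun _ => Submodule.finrank_le _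
    | succ k ih =>
      intro hk
      have := hlt k (by lia)
      have := ih (by lia)
      lia
  have := hsum _ le_rfl
  lia
open scoped MatrixOrder Matrix.Norms.L2Operator in
/-- Spectrahedral shadows can be described by real quadratic forms. -/
lemma IsSpectrahedralShadow.exists_real {V : Type*} [AddCommGroup V] [Module ℝ V] {S : Set V}
    (h : IsSpectrahedralShadow S) :
    ∃ (n : ℕ) (ι : Type) (_ : Fintype ι) (B₀ : ι → ι → ℝ) (B : Fin n → ι → ι → ℝ)
      (L : (Fin n → ℝ) →ₗ[ℝ] V),
      (∀ v ∈ S, ∃ y, L y = v ∧ ∃ D : ι → ι → ℝ, ∀ a b,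
        B₀ a b + ∑ j, y j * B j a b = ∑ k, D k a * D k b) ∧
      ∀ y : Fin n → ℝ, (∀ w : ι → ℝ,
        0 ≤ ∑ a, ∑ b, w a * w b * (B₀ a b + ∑ j, y j * B j a b)) → L y ∈ S := by
  obtain ⟨n, m, A₀, A, L, hA₀, hA, rfl⟩ := h
  let c : Fin 2 → ℂ := ![1, Complex.I]
  let re : Matrix (Fin m) (Fin m) ℂ → Fin m × Fin 2 → Fin m × Fin 2 → ℝ := fun M a b =>
    (star (c a.2) * M a.1 b.1 * c b.2).re
  have hre : ∀ (y : Fin n → ℝ) a b, re A₀ a b + ∑ j, y j * re (A j) a b =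
      re (A₀ + ∑ j, y j • A j) a b := by
    intro y a b
    simp only [re, Matrix.add_apply, Matrix.sum_apply, Matrix.smul_apply, mul_add, add_mul,
      Complex.add_re, Finset.mul_sum, Finset.sum_mul, Complex.re_sum]
    congr 1
    refine Finset.sum_congr rfl fun j _ => ?_
    rw [mul_smul_comm, smul_mul_assoc, Complex.smul_re, smul_eq_mul]
  refine ⟨n, Fin m × Fin 2, inferInstance, re A₀, fun j => re (A j), L, ?_, fun y hy => ?_⟩
  · rintro _ ⟨y, hy, rfl⟩
    refine ⟨y, rfl, ?_⟩
    obtain ⟨B, hB⟩ : ∃ B : Matrix (Fin m) (Fin m) ℂ, A₀ + ∑ j, y j • A j = Bᴴ * B := by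
      exact CStarAlgebra.nonneg_iff_eq_star_mul_self.mp (Matrix.nonneg_iff_posSemidef.mpr hy)
    refine ⟨fun k a => if k.2 = 0 then (B k.1 a.1 * c a.2).re else (B k.1 a.1 * c a.2).im,
      fun a b => ?_⟩
    rw [hre, hB]
    simp only [re, Matrix.mul_apply, Matrix.conjTranspose_apply, Finset.mul_sum, Finset.sum_mul,
      Complex.re_sum, Fintype.sum_prod_type, Fin.sum_univ_two]
    refine Finset.sum_congr rfl fun k _ => ?_
    simp [Complex.mul_re, Complex.mul_im]
    ring
  · have hH : (A₀ + ∑ j, y j • A j).IsHermitian :=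
      hA₀.add (by
        rw [Matrix.IsHermitian, Matrix.conjTranspose_sum]
        exact Finset.sum_congr rfl fun j _ => by
          rw [Matrix.conjTranspose_smul, (hA j).eq, star_trivial])
    refine ⟨y, .of_dotProduct_mulVec_nonneg hH fun W => ?_, rfl⟩
    have him : (star W ⬝ᵥ (A₀ + ∑ j, y j • A j) *ᵥ W).im = 0 := hH.im_star_dotProduct_mulVec_self W
    rw [Complex.nonneg_iff]
    refine ⟨(hy fun a => if a.2 = 0 then (W a.1).re else (W a.1).im).trans_eq ?_, him.symm⟩
    simp only [hre]
    simp only [re, dotProduct, Matrix.mulVec, Finset.mul_sum, Complex.re_sum,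
      Fintype.sum_prod_type, Fin.sum_univ_two, ← Finset.sum_add_distrib]
    refine Finset.sum_congr rfl fun a _ => Finset.sum_congr rfl fun b _ => ?_
    simp [c, Complex.mul_re, Complex.mul_im]
    ring

/-- Linear images of spectrahedral shadows are spectrahedral shadows. -/
lemma IsSpectrahedralShadow.image {V W : Type*} [AddCommGroup V] [Module ℝ V] [AddCommGroup W]
    [Module ℝ W] {S : Set V} (h : IsSpectrahedralShadow S) (Γ : V →ₗ[ℝ] W) :
    IsSpectrahedralShadow (Γ '' S) := by
  obtain ⟨n, m, A₀, A, L, hA₀, hA, rfl⟩ := h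
  exact ⟨n, m, A₀, A, Γ ∘ₗ L, hA₀, hA, by rw [LinearMap.coe_comp, Set.image_comp]⟩

open MvPolynomial in
lemma truncMoment_aeval_scale {σ : Type*} (m : (σ →₀ ℕ) → ℝ) (r : ℕ) {ε : ℝ} (hε : ε ≠ 0)
    (p : MvPolynomial σ ℝ) (hp : ∀ α ∈ p.support, α.degree ≤ r) :
    truncMoment m r ε (aeval (fun j => C ε⁻¹ * X j) p) =
      ∑ α ∈ p.support, p.coeff α * m α := by
  conv_lhs => rw [p.as_sum]
  rw [map_sum, map_sum]
  refine Finset.sum_congr rfl fun α hα => ?_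
  have h : aeval (fun j : σ => (C ε⁻¹ * X j : MvPolynomial σ ℝ)) (monomial α (p.coeff α)) =
      monomial α (p.coeff α * ε⁻¹ ^ α.degree) := by
    rw [aeval_monomial, monomial_eq, algebraMap_eq, C_mul, mul_assoc]
    congr 1
    simp only [Finsupp.prod, mul_pow, Finset.prod_mul_distrib, Finset.prod_pow_eq_pow_sum,
      Finsupp.degree_apply, map_pow]
  rw [h, truncMoment_monomial, if_pos (hp α hα)]
  have : ε ^ α.degree ≠ 0 := pow_ne_zero _ hε
  rw [inv_pow]
  field_simp

open MvPolynomial in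
lemma truncMoment_eq_zero_of_mem_pow {σ : Type*} (m : (σ →₀ ℕ) → ℝ) {r N : ℕ} (h : r < N) (ε : ℝ)
    {f : MvPolynomial σ ℝ} (hf : f ∈ idealOfVars σ ℝ ^ N) : truncMoment m r ε f = 0 := by
  rw [f.as_sum, map_sum]
  refine Finset.sum_eq_zero fun α hα => ?_
  have := (mem_pow_idealOfVars_iff N f).1 hf α hα
  rw [truncMoment_monomial, if_neg (by lia), mul_zero]

lemma MomentPosOn.zero_pos {σ : Type*} {m : (σ →₀ ℕ) → ℝ} {Γ : Finset (σ →₀ ℕ)}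
    (hm : MomentPosOn m Γ) (h0 : 0 ∈ Γ) : 0 < m 0 := by
  classical
  have := hm (fun α => if α = 0 then 1 else 0) ⟨0, h0, by simp⟩
  simpa [h0] using this

open MvPolynomial Filter Topology in
/-- A functional on polynomials, normalized and vanishing in high degrees, that is nonnegative on
squares from `V₀` but negative on a rescaling of `p`. -/
lemma exists_functional {σ : Type*} [Finite σ] (p : MvPolynomial σ ℝ)
    (h2 : ∀ r, ∃ m, MomentPosOn m (exponentsLE σ r) ∧ ∑ α ∈ p.support, p.coeff α * m α < 0)
    (V₀ : Submodule ℝ (MvPolynomial σ ℝ)) [FiniteDimensional ℝ V₀] {M : ℕ}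
    (hM : Module.finrank ℝ V₀ ≤ M) :
    ∃ (Λ : MvPolynomial σ ℝ →ₗ[ℝ] ℝ) (ε : ℝ), 0 < ε ∧ Λ 1 = 1 ∧
      (∀ f ∈ idealOfVars σ ℝ ^ (2 * ((p.totalDegree + 1) * 2 ^ M) + 1), Λ f = 0) ∧
      (∀ f ∈ V₀, 0 ≤ Λ (f * f)) ∧ Λ (aeval (fun j => C ε⁻¹ * X j) p) < 0 := by
  obtain ⟨k, hk, hgap⟩ := exists_degree_gap V₀ (p.totalDegree + 1)
  set r := (p.totalDegree + 1) * 2 ^ k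
  have hr1 : p.totalDegree + 1 ≤ r := Nat.le_mul_of_pos_right _ (by positivity)
  have hr2 : r ≤ (p.totalDegree + 1) * 2 ^ M :=
    Nat.mul_le_mul_left _ (Nat.pow_le_pow_right (by norm_num) (hk.trans hM))
  obtain ⟨m, hm, hneg⟩ := h2 r
  have hm0 : 0 < m 0 := hm.zero_pos (by simp)
  obtain ⟨ε, hε, hε0⟩ := ((eventually_truncMoment_mul_self_nonneg m r hm V₀ hgap).and
    self_mem_nhdsWithin).exists
  have hε0 : 0 < ε := hε0
  refine ⟨(m 0)⁻¹ • truncMoment m (2 * r) ε, ε, hε0, ?_, fun f hf => ?_, fun f hf => ?_, ?_⟩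
  · have : truncMoment m (2 * r) ε 1 = m 0 := by
      rw [← C_1, C_apply, truncMoment_monomial]
      simp
    rw [LinearMap.smul_apply, this, smul_eq_mul, inv_mul_cancel₀ hm0.ne']
  · rw [LinearMap.smul_apply, truncMoment_eq_zero_of_mem_pow m (by lia) ε hf, smul_zero]
  · exact smul_nonneg (inv_nonneg.2 hm0.le) (hε f hf)
  · rw [LinearMap.smul_apply, truncMoment_aeval_scale m _ hε0.ne' p fun α hα => ?_]
    · exact mul_neg_of_pos_of_neg (inv_pos.2 hm0) hneg
    · have : α.degree ≤ p.totalDegree := by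
        simpa [Finsupp.degree_apply, Finsupp.sum] using le_totalDegree hα
      lia

open MvPolynomial in
/-- A criterion for not being a spectrahedral shadow: the set contains a family of points on which
functionals that are nonnegative on the set restrict to rescalings, around any point, of a
polynomial that is not nonnegative for some positive definite moments. -/
theorem not_isSpectrahedralShadow_of_moments {V σ : Type*} [AddCommGroup V] [Module ℝ V]
    [Finite σ] {S : Set V} (Φ : (σ → ℝ) → V) (hΦ : ∀ x, Φ x ∈ S) (p : MvPolynomial σ ℝ)
    (h1 : ∀ (i : σ → ℝ) (ε : ℝ), 0 < ε → ∃ φ : V →ₗ[ℝ] ℝ,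
      (∀ v ∈ S, 0 ≤ φ v) ∧ ∀ z, φ (Φ (i + ε • z)) = eval z p)
    (h2 : ∀ r, ∃ m, MomentPosOn m (exponentsLE σ r) ∧
      ∑ α ∈ p.support, p.coeff α * m α < 0) :
    ¬ IsSpectrahedralShadow S := by
  classical
  intro hS
  obtain ⟨n, ι, _, B₀, B, L, hlift, hmem⟩ := hS.exists_real
  choose y hy D hD using fun x => hlift (Φ x) (hΦ x)
  set M := Fintype.card (ι × ι)
  set N := 2 * ((p.totalDegree + 1) * 2 ^ M)
  obtain ⟨i, τ, hτ⟩ := exists_jet (κ := Fin n ⊕ (ι × ι))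
    (Sum.elim (fun j x => y x j) fun ka x => D x ka.1 ka.2) N
  let q : ι × ι → MvPolynomial σ ℝ := fun ka => τ (.inr ka)
  have := FiniteDimensional.span_of_finite ℝ (Set.finite_range q)
  obtain ⟨Λ, ε, hε, hΛ1, hΛ0, hΛsq, hΛp⟩ := exists_functional p h2
    (Submodule.span ℝ (Set.range q)) (M := M) (finrank_range_le_card q)
  have hΛC : ∀ a, Λ (C a) = a := fun a => by
    rw [← mul_one (C a), C_mul', map_smul, hΛ1, smul_eq_mul, mul_one]
  let y' : Fin n → ℝ := fun j => Λ (τ (.inl j))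
  have hrel : ∀ a b, B₀ a b + ∑ j, y' j * B j a b = ∑ k, Λ (q (k, a) * q (k, b)) := by
    intro a b
    have := hΛ0 _ (hτ (C (B₀ a b) + ∑ j, C (B j a b) * X (.inr (.inl j)) -
      ∑ k, X (.inr (.inr (k, a))) * X (.inr (.inr (k, b)))) fun x => ?_)
    · simp only [map_sub, map_add, map_sum, map_mul, aeval_X, algHom_C, algebraMap_eq,
        Sum.elim_inr, C_mul', map_smul, hΛC, smul_eq_mul] at this
      simp only [y', q]
      simp only [mul_comm (Λ _) (B _ a b)]
      linarith
    · have := hD x a b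
      simp only [map_sub, map_add, map_sum, map_mul, eval_C, eval_X, Sum.elim_inr, Sum.elim_inl]
      simp only [mul_comm (B _ a b)]
      linarith
  have hL : L y' ∈ S := by
    refine hmem y' fun w => ?_
    have : ∑ a, ∑ b, w a * w b * (B₀ a b + ∑ j, y' j * B j a b) =
        ∑ k, Λ ((∑ a, w a • q (k, a)) * ∑ a, w a • q (k, a)) := by
      simp only [hrel, Finset.sum_mul_sum, map_sum, smul_mul_smul_comm, map_smul, smul_eq_mul]
      simp only [Finset.mul_sum]
      rw [eq_comm, Finset.sum_comm]
      exact Finset.sum_congr rfl fun a _ => Finset.sum_comm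
    rw [this]
    exact Finset.sum_nonneg fun k _ => hΛsq _ <| Submodule.sum_mem _ fun a _ =>
      Submodule.smul_mem _ _ (Submodule.subset_span ⟨_, rfl⟩)
  obtain ⟨φ, hφ, hφp⟩ := h1 i ε hε
  refine (hφ _ hL).not_gt ?_
  have hφL : ∀ u : Fin n → ℝ, φ (L u) = ∑ j, u j * φ (L (Pi.single j 1)) := by
    intro u
    conv_lhs => rw [← Finset.univ_sum_single u]
    simp only [map_sum]
    refine Finset.sum_congr rfl fun j _ => ?_
    rw [← smul_eq_mul, ← map_smul, ← map_smul, ← Pi.single_smul, smul_eq_mul, mul_one]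
  have hz : φ (L y') = Λ (aeval (fun j => C ε⁻¹ * X j) p) := by
    have := hΛ0 _ (hτ (∑ j, C (φ (L (Pi.single j 1))) * X (.inr (.inl j)) -
      aeval (fun j => C ε⁻¹ * (X (.inl j) - C (i j))) p) fun x => ?_)
    · rw [map_sub, map_sub, sub_eq_zero] at this
      rw [hφL]
      simp only [map_sum, aeval_X, Sum.elim_inr, C_mul', map_smul, smul_eq_mul] at this
      simp only [y', mul_comm (Λ _)]
      rw [this, ← AlgHom.comp_apply, comp_aeval]
      simp [C_mul']
    · have hx : Φ x = Φ (i + ε • fun j => ε⁻¹ * (x j - i j)) := by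
        congr 1
        ext j
        simp [hε.ne']
      have h3 := hφL (y x)
      rw [hy, hx, hφp] at h3
      rw [map_sub, sub_eq_zero, ← coe_aeval_eq_eval, RingHom.coe_coe, ← AlgHom.comp_apply,
        comp_aeval]
      rw [← aeval_eq_eval] at h3
      simpa [mul_comm (φ _)] using h3.symm
  rwa [hz]

/-- The exponent of the `i`-th homogeneous coordinate, the zeroth one being `1`, for the variables
in the range of `g`. -/
noncomputable def coordExp {σ : Type*} {a : ℕ} (g : Fin a → σ) : Fin (a + 1) → σ →₀ ℕ :=
  Fin.cons 0 fun i => Finsupp.single (g i) 1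

lemma coordExp_prod {σ : Type*} {a : ℕ} (g : Fin a → σ) (z : σ → ℝ) (i : Fin (a + 1)) :
    (coordExp g i).prod (fun k e => z k ^ e) =
      (Fin.cons 1 fun j => z (g j) : Fin (a + 1) → ℝ) i := by
  cases i using Fin.cases <;> simp [coordExp]

/-- The exponent of a product of two homogeneous coordinates from separate groups of variables. -/
noncomputable def biExp {a b : ℕ} (t : Fin (a + 1) × Fin (b + 1)) : Fin a ⊕ Fin b →₀ ℕ :=
  coordExp Sum.inl t.1 + coordExp Sum.inr t.2

lemma biExp_inl {a b : ℕ} (t : Fin (a + 1) × Fin (b + 1)) (k : Fin a) :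
    biExp t (Sum.inl k) = if t.1 = k.succ then 1 else 0 := by
  obtain ⟨i, j⟩ := t
  cases i using Fin.cases <;> cases j using Fin.cases <;>
    simp [biExp, coordExp, Finsupp.single_apply, Fin.succ_ne_zero, eq_comm]

lemma biExp_inr {a b : ℕ} (t : Fin (a + 1) × Fin (b + 1)) (k : Fin b) :
    biExp t (Sum.inr k) = if t.2 = k.succ then 1 else 0 := by
  obtain ⟨i, j⟩ := t
  cases i using Fin.cases <;> cases j using Fin.cases <;>
    simp [biExp, coordExp, Finsupp.single_apply, Fin.succ_ne_zero, eq_comm]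

lemma pair_eq_of_indicator_add_eq {a : ℕ} {i i' k k' : Fin (a + 1)}
    (h : ∀ t : Fin a, ((if i = t.succ then 1 else 0) + if i' = t.succ then 1 else 0 : ℕ) =
      (if k = t.succ then 1 else 0) + if k' = t.succ then 1 else 0) :
    i = k ∧ i' = k' ∨ i = k' ∧ i' = k := by
  have h' : ∀ t : Fin (a + 1), t ≠ 0 →
      ((if i = t then 1 else 0) + if i' = t then 1 else 0 : ℕ) =
        (if k = t then 1 else 0) + if k' = t then 1 else 0 := by
    intro t ht
    obtain ⟨t, rfl⟩ := Fin.exists_succ_eq.2 ht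
    exact h t
  have h1 := h' i
  have h2 := h' i'
  have h3 := h' k
  have h4 := h' k'
  grind

lemma biExp_injective {a b : ℕ} :
    Function.Injective (biExp : Fin (a + 1) × Fin (b + 1) → Fin a ⊕ Fin b →₀ ℕ) := by
  intro s t h
  have h1 := pair_eq_of_indicator_add_eq (i := s.1) (i' := s.1) (k := t.1) (k' := t.1) fun k => by
    rw [← biExp_inl, ← biExp_inl, h]
  have h2 := pair_eq_of_indicator_add_eq (i := s.2) (i' := s.2) (k := t.2) (k' := t.2) fun k => by
    rw [← biExp_inr, ← biExp_inr, h]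
  exact Prod.ext (by tauto) (by tauto)

/-- Biquadratic moments can be prescribed by a tensor that is symmetric in each pair of indices. -/
lemma exists_moments_of_tensor {a b : ℕ}
    (T : Fin (a + 1) → Fin (a + 1) → Fin (b + 1) → Fin (b + 1) → ℝ)
    (hT₁ : ∀ i i' j j', T i i' j j' = T i' i j j') (hT₂ : ∀ i i' j j', T i i' j j' = T i i' j' j) :
    ∃ m : (Fin a ⊕ Fin b →₀ ℕ) → ℝ, ∀ s t, m (biExp s + biExp t) = T s.1 t.1 s.2 t.2 := by
  classical
  let P : (Fin a ⊕ Fin b →₀ ℕ) → (Fin (a + 1) × Fin (b + 1)) × (Fin (a + 1) × Fin (b + 1)) → Prop :=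
    fun α q => α = biExp q.1 + biExp q.2
  refine ⟨fun α => if h : ∃ q, P α q then
    T h.choose.1.1 h.choose.2.1 h.choose.1.2 h.choose.2.2 else 0, fun s t => ?_⟩
  have h : ∃ q, P (biExp s + biExp t) q := ⟨(s, t), rfl⟩
  beta_reduce
  rw [dif_pos h]
  have hc : biExp s + biExp t = biExp h.choose.1 + biExp h.choose.2 := h.choose_spec
  generalize h.choose = q at hc
  have h1 := pair_eq_of_indicator_add_eq (i := s.1) (i' := t.1) (k := q.1.1) (k' := q.2.1)
    fun k => by
      simp only [← biExp_inl]
      exact DFunLike.congr_fun hc (Sum.inl k)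
  have h2 := pair_eq_of_indicator_add_eq (i := s.2) (i' := t.2) (k := q.1.2) (k' := q.2.2)
    fun k => by
      simp only [← biExp_inr]
      exact DFunLike.congr_fun hc (Sum.inr k)
  rcases h1 with ⟨h1, h1'⟩ | ⟨h1, h1'⟩ <;> rcases h2 with ⟨h2, h2'⟩ | ⟨h2, h2'⟩ <;>
    rw [h1, h1', h2, h2']
  · exact hT₂ _ _ _ _
  · exact hT₁ _ _ _ _
  · rw [hT₁, hT₂]

/-- The polynomial obtained from a biquadratic form by dehomogenization. -/
noncomputable def biquadratic {a b : ℕ}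
    (Q : Fin (a + 1) × Fin (b + 1) → Fin (a + 1) × Fin (b + 1) → ℝ) :
    MvPolynomial (Fin a ⊕ Fin b) ℝ :=
  ∑ s, ∑ t, MvPolynomial.monomial (biExp s + biExp t) (Q s t)

open MvPolynomial in
lemma eval_biquadratic {a b : ℕ} (Q : Fin (a + 1) × Fin (b + 1) → Fin (a + 1) × Fin (b + 1) → ℝ)
    (z : Fin a ⊕ Fin b → ℝ) (x : Fin (a + 1) → ℝ) (hx : x = Fin.cons 1 fun i => z (Sum.inl i))
    (y : Fin (b + 1) → ℝ) (hy : y = Fin.cons 1 fun i => z (Sum.inr i)) :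
    eval z (biquadratic Q) = ∑ s, ∑ t, Q s t * ((x s.1 * y s.2) * (x t.1 * y t.2)) := by
  have h : ∀ α β : Fin a ⊕ Fin b →₀ ℕ, (α + β).prod (fun k e => z k ^ e) =
      α.prod (fun k e => z k ^ e) * β.prod (fun k e => z k ^ e) := fun α β =>
    Finsupp.prod_add_index' (fun _ => pow_zero _) fun _ _ _ => pow_add _ _ _
  simp only [biquadratic, map_sum, eval_monomial, h, biExp, coordExp_prod, ← hx, ← hy]

open MvPolynomial in
lemma sum_support_biquadratic {a b : ℕ}
    (Q : Fin (a + 1) × Fin (b + 1) → Fin (a + 1) × Fin (b + 1) → ℝ)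
    (m : (Fin a ⊕ Fin b →₀ ℕ) → ℝ) :
    ∑ α ∈ (biquadratic Q).support, (biquadratic Q).coeff α * m α =
      ∑ s, ∑ t, Q s t * m (biExp s + biExp t) := by
  have h : ∀ (α : Fin a ⊕ Fin b →₀ ℕ) (c : ℝ),
      (basisMonomials (Fin a ⊕ Fin b) ℝ).constr ℝ m (monomial α c) = c * m α := by
    intro α c
    have : monomial α c = c • basisMonomials _ ℝ α := by simp [smul_monomial]
    rw [this, map_smul, Module.Basis.constr_basis, smul_eq_mul]
  calc _ = (basisMonomials (Fin a ⊕ Fin b) ℝ).constr ℝ m (biquadratic Q) := by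
        conv_rhs => rw [(biquadratic Q).as_sum]
        simp only [map_sum, h]
    _ = _ := by simp only [biquadratic, map_sum, h]

open MvPolynomial in
lemma exists_of_mem_support_biquadratic {a b : ℕ}
    {Q : Fin (a + 1) × Fin (b + 1) → Fin (a + 1) × Fin (b + 1) → ℝ} {α : Fin a ⊕ Fin b →₀ ℕ}
    (hα : α ∈ (biquadratic Q).support) : ∃ s t, α = biExp s + biExp t := by
  classical
  by_contra! h
  refine mem_support_iff.1 hα ?_
  simp only [biquadratic, coeff_sum, coeff_monomial]
  exact Finset.sum_eq_zero fun s _ => Finset.sum_eq_zero fun t _ => if_neg (h s t).symm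

/-- Positive semidefinite biquadratic moments that are negative on a biquadratic form can be
perturbed and extended to positive definite moments that are negative on it. -/
lemma exists_momentPosOn_biquadratic {a b : ℕ}
    (T : Fin (a + 1) → Fin (a + 1) → Fin (b + 1) → Fin (b + 1) → ℝ)
    (hT₁ : ∀ i i' j j', T i i' j j' = T i' i j j') (hT₂ : ∀ i i' j j', T i i' j j' = T i i' j' j)
    (hT : ∀ f : Fin (a + 1) × Fin (b + 1) → ℝ,
      0 ≤ ∑ s, ∑ t, f s * f t * T s.1 t.1 s.2 t.2)
    (Q : Fin (a + 1) × Fin (b + 1) → Fin (a + 1) × Fin (b + 1) → ℝ)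
    (hQ : ∑ s, ∑ t, Q s t * T s.1 t.1 s.2 t.2 < 0) (Γ : Finset (Fin a ⊕ Fin b →₀ ℕ)) :
    ∃ m, MomentPosOn m Γ ∧
      ∑ α ∈ (biquadratic Q).support, (biquadratic Q).coeff α * m α < 0 := by
  classical
  obtain ⟨m₀, hm₀⟩ := exists_moments_of_tensor T hT₁ hT₂
  let Γb : Finset (Fin a ⊕ Fin b →₀ ℕ) := Finset.univ.image biExp
  obtain ⟨m₁, hm₁⟩ := exists_momentPosOn Γb
  let A := ∑ s, ∑ t, Q s t * m₁ (biExp s + biExp t)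
  obtain ⟨η, hη, hη'⟩ : ∃ η > 0, ∑ s, ∑ t, Q s t * T s.1 t.1 s.2 t.2 + η * A < 0 := by
    set c := ∑ s, ∑ t, Q s t * T s.1 t.1 s.2 t.2
    refine ⟨-c / (2 * (|A| + 1)), by have := abs_nonneg A; apply div_pos <;> linarith, ?_⟩
    have h1 : -c / (2 * (|A| + 1)) * A ≤ -c / (2 * (|A| + 1)) * (|A| + 1) := by
      refine mul_le_mul_of_nonneg_left ?_ ?_
      · linarith [le_abs_self A]
      · have := abs_nonneg A; apply div_nonneg <;> linarith
    have h2 : -c / (2 * (|A| + 1)) * (|A| + 1) = -c / 2 := by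
      have : |A| + 1 ≠ 0 := by positivity
      field_simp
    linarith
  let m := fun α => m₀ α + η * m₁ α
  have hm : MomentPosOn m Γb := by
    intro G hG
    have h1 := hm₁ G hG
    have h0 : 0 ≤ ∑ β ∈ Γb, ∑ γ ∈ Γb, G β * G γ * m₀ (β + γ) := by
      simpa only [Γb, Finset.sum_image biExp_injective.injOn, hm₀] using hT fun s => G (biExp s)
    have : ∑ β ∈ Γb, ∑ γ ∈ Γb, G β * G γ * m (β + γ) =
        ∑ β ∈ Γb, ∑ γ ∈ Γb, G β * G γ * m₀ (β + γ) +
          η * ∑ β ∈ Γb, ∑ γ ∈ Γb, G β * G γ * m₁ (β + γ) := by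
      simp only [m, Finset.mul_sum, ← Finset.sum_add_distrib]
      refine Finset.sum_congr rfl fun _ _ => Finset.sum_congr rfl fun _ _ => by ring
    rw [this]
    have := mul_pos hη h1
    linarith
  have hneg : ∑ α ∈ (biquadratic Q).support, (biquadratic Q).coeff α * m α < 0 := by
    rw [sum_support_biquadratic]
    simpa only [m, mul_add, hm₀, Finset.sum_add_distrib, A, Finset.mul_sum, mul_left_comm η]
      using hη'
  let wx : (Fin a ⊕ Fin b →₀ ℕ) → ℕ := fun α => ∑ i, α (Sum.inl i)
  let wy : (Fin a ⊕ Fin b →₀ ℕ) → ℕ := fun α => ∑ i, α (Sum.inr i)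
  have hwx : ∀ α β, wx (α + β) = wx α + wx β := fun α β => by
    simp [wx, Finset.sum_add_distrib]
  have hwy : ∀ α β, wy (α + β) = wy α + wy β := fun α β => by
    simp [wy, Finset.sum_add_distrib]
  have hind : ∀ {k : ℕ} (i : Fin (k + 1)), ∑ l : Fin k, (if i = l.succ then 1 else 0) ≤ 1 := by
    intro k i
    cases i using Fin.cases with
    | zero => simp [(Fin.succ_ne_zero _).symm]
    | succ i => simp [Fin.succ_inj]
  have hwx1 : ∀ t : Fin (a + 1) × Fin (b + 1), wx (biExp t) ≤ 1 := fun t => by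
    simpa only [wx, biExp_inl] using hind t.1
  have hwy1 : ∀ t : Fin (a + 1) × Fin (b + 1), wy (biExp t) ≤ 1 := fun t => by
    simpa only [wy, biExp_inr] using hind t.2
  have hsub : (Γ.filter fun α => wy α ≤ 1).filter (fun α => wx α ≤ 1) ⊆ Γb := by
    have hex : ∀ {k : ℕ} (f : Fin k → ℕ), ∑ l, f l ≤ 1 →
        ∃ i : Fin (k + 1), ∀ l, f l = if i = l.succ then 1 else 0 := by
      intro k f hf
      by_cases h : ∃ l, f l ≠ 0
      · obtain ⟨l, hl⟩ := h
        refine ⟨l.succ, fun l' => ?_⟩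
        by_cases hll : l = l'
        · subst hll
          have := Finset.single_le_sum (f := f) (fun _ _ => Nat.zero_le _) (Finset.mem_univ l)
          simp
          lia
        · have : ∑ i ∈ {l, l'}, f i ≤ ∑ i, f i :=
            Finset.sum_le_sum_of_subset (Finset.subset_univ _)
          rw [Finset.sum_pair hll] at this
          simp [hll]
          lia
      · push Not at h
        exact ⟨0, fun l => by simp [h l, (Fin.succ_ne_zero _).symm]⟩
    intro α hα
    simp only [Finset.mem_filter] at hα
    obtain ⟨i, hi⟩ := hex (fun l => α (Sum.inl l)) hα.2
    obtain ⟨j, hj⟩ := hex (fun l => α (Sum.inr l)) hα.1.2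
    refine Finset.mem_image.2 ⟨(i, j), Finset.mem_univ _, ?_⟩
    ext (k | k)
    · rw [biExp_inl, hi]
    · rw [biExp_inr, hj]
  obtain ⟨m', hm', hneg'⟩ := MomentPosOn.exists_extend wx hwx 1 (Γ.filter fun α => wy α ≤ 1) m
    (hm.mono hsub) (biquadratic Q) (fun α hα => by
      obtain ⟨s, t, rfl⟩ := exists_of_mem_support_biquadratic hα
      linarith [hwx (biExp s) (biExp t), hwx1 s, hwx1 t]) hneg
  exact MomentPosOn.exists_extend wy hwy 1 Γ m' hm' (biquadratic Q) (fun α hα => by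
      obtain ⟨s, t, rfl⟩ := exists_of_mem_support_biquadratic hα
      linarith [hwy (biExp s) (biExp t), hwy1 s, hwy1 t]) hneg'

/-- The bilinear form with coefficients `k`. -/
noncomputable def biForm {d s : ℕ} (k : Fin d × Fin s → ℂ) (u : Fin d → ℂ) (v : Fin s → ℂ) : ℂ :=
  ∑ t, k t * (u t.1 * v t.2)

/-- The functional on matrices that on pure product states is the sum of the squared absolute values
of the bilinear forms `k l` at `(u, v)` and at `(u, star v)`, minus `ε` times the trace. -/
noncomputable def witness {d s q : ℕ} (k : Fin q → Fin d × Fin s → ℂ) (ε : ℝ) :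
    Matrix (Fin d × Fin s) (Fin d × Fin s) ℂ →ₗ[ℝ] ℝ where
  toFun ρ := (∑ l, ∑ t, ∑ t', k l t * star (k l t') *
    (ρ t t' + ρ (t.1, t'.2) (t'.1, t.2))).re - ε * ρ.trace.re
  map_add' ρ ρ' := by
    simp only [Matrix.add_apply, Matrix.trace_add, Complex.add_re, Complex.re_sum, mul_add,
      Finset.sum_add_distrib]
    ring
  map_smul' c ρ := by
    simp only [Matrix.smul_apply, Matrix.trace_smul, Complex.smul_re, Complex.re_sum, mul_add,
      mul_smul_comm, Complex.add_re, ← smul_add, smul_eq_mul, RingHom.id_apply, mul_sub,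
      Finset.mul_sum]
    ring

/-- The pure product state of two vectors. -/
noncomputable def pureProduct {d s : ℕ} (u : Fin d → ℂ) (v : Fin s → ℂ) :
    Matrix (Fin d × Fin s) (Fin d × Fin s) ℂ :=
  vecMulVec u (star u) ⊗ₖ vecMulVec v (star v)

lemma separableMat_pureProduct {d s : ℕ} (u : Fin d → ℂ) (v : Fin s → ℂ) :
    SeparableMat (pureProduct u v) :=
  ⟨1, fun _ => vecMulVec u (star u), fun _ => vecMulVec v (star v),
    fun _ => posSemidef_vecMulVec_self_star u, fun _ => posSemidef_vecMulVec_self_star v, by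
      simp [pureProduct]⟩

lemma SeparableMat.exists_sum_pureProduct {d s : ℕ}
    {ρ : Matrix (Fin d × Fin s) (Fin d × Fin s) ℂ} (h : SeparableMat ρ) :
    ∃ (ι : Type) (_ : Fintype ι) (u : ι → Fin d → ℂ) (v : ι → Fin s → ℂ),
      ρ = ∑ i, pureProduct (u i) (v i) := by
  obtain ⟨r, σ, τ, hσ, hτ, rfl⟩ := h
  choose m u hu using fun i => Matrix.posSemidef_iff_eq_sum_vecMulVec.1 (hσ i)
  choose n v hv using fun i => Matrix.posSemidef_iff_eq_sum_vecMulVec.1 (hτ i)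
  refine ⟨Σ i : Fin r, Fin (m i) × Fin (n i), inferInstance, fun t => u t.1 t.2.1,
    fun t => v t.1 t.2.2, ?_⟩
  rw [Fintype.sum_sigma]
  refine Finset.sum_congr rfl fun i _ => ?_
  ext a b
  rw [hu, hv, Fintype.sum_prod_type]
  simp only [pureProduct, kroneckerMap_apply, Matrix.sum_apply, Finset.sum_mul_sum]

lemma witness_pureProduct {d s q : ℕ} (k : Fin q → Fin d × Fin s → ℂ) (ε : ℝ) (u : Fin d → ℂ)
    (v : Fin s → ℂ) : witness k ε (pureProduct u v) =
      ∑ l, (Complex.normSq (biForm (k l) u v) + Complex.normSq (biForm (k l) u (star v))) -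
        ε * ((∑ a, Complex.normSq (u a)) * ∑ b, Complex.normSq (v b)) := by
  have hn : ∀ z : ℂ, Complex.normSq z = (z * star z).re := fun z => by
    rw [Complex.star_def, Complex.mul_conj, Complex.ofReal_re]
  have htr : ∀ {n : ℕ} (w : Fin n → ℂ),
      w ⬝ᵥ star w = ((∑ a, Complex.normSq (w a) : ℝ) : ℂ) := fun w => by
    simp [dotProduct, Complex.mul_conj]
  simp only [witness, LinearMap.coe_mk, AddHom.coe_mk, pureProduct, trace_kronecker,
    trace_vecMulVec, htr]
  rw [← Complex.ofReal_mul, Complex.ofReal_re, Complex.re_sum]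
  congr 1
  refine Finset.sum_congr rfl fun l _ => ?_
  rw [hn, hn, ← Complex.add_re]
  congr 1
  simp only [biForm, star_sum, Finset.sum_mul_sum, ← Finset.sum_add_distrib]
  refine Finset.sum_congr rfl fun t _ => Finset.sum_congr rfl fun t' _ => ?_
  simp only [kroneckerMap_apply, vecMulVec_apply, Pi.star_apply, star_mul', star_star]
  ring

/-- A positive biquadratic function is bounded below by a multiple of the squared norms. -/
lemma exists_pos_mul_norm_sq_le {E F : Type*} [NormedAddCommGroup E] [NormedSpace ℝ E]
    [ProperSpace E] [NormedAddCommGroup F] [NormedSpace ℝ F] [ProperSpace F] (f : E → F → ℝ)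
    (hs : ∀ (a b : ℝ) u v, f (a • u) (b • v) = a ^ 2 * b ^ 2 * f u v)
    (hpos : ∀ u v, u ≠ 0 → v ≠ 0 → 0 < f u v) (hc : Continuous fun w : E × F => f w.1 w.2) :
    ∃ c > 0, ∀ u v, c * (‖u‖ ^ 2 * ‖v‖ ^ 2) ≤ f u v := by
  obtain ⟨c, hc, hcf⟩ : ∃ c > 0, ∀ u v, ‖u‖ = 1 → ‖v‖ = 1 → c ≤ f u v := by
    have hK : IsCompact (Metric.sphere (0 : E) 1 ×ˢ Metric.sphere (0 : F) 1) :=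
      (isCompact_sphere _ _).prod (isCompact_sphere _ _)
    have hmem : ∀ {u v}, (u, v) ∈ Metric.sphere (0 : E) 1 ×ˢ Metric.sphere (0 : F) 1 ↔
      ‖u‖ = 1 ∧ ‖v‖ = 1 := by simp
    rcases (Metric.sphere (0 : E) 1 ×ˢ Metric.sphere (0 : F) 1).eq_empty_or_nonempty with hE | hE
    · refine ⟨1, one_pos, fun u v hu hv => ?_⟩
      have := hmem.2 ⟨hu, hv⟩
      simp [hE] at this
    · obtain ⟨w, hw, hmin⟩ := hK.exists_isMinOn hE hc.continuousOn
      have hw' := hmem.1 hw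
      exact ⟨f w.1 w.2, hpos _ _ (norm_ne_zero_iff.1 (by simp [hw'.1]))
        (norm_ne_zero_iff.1 (by simp [hw'.2])), fun u v hu hv => hmin (hmem.2 ⟨hu, hv⟩)⟩
  refine ⟨c, hc, fun u v => ?_⟩
  by_cases hu : u = 0
  · have := hs 0 1 u v
    simp [hu] at this ⊢
    exact this.ge
  by_cases hv : v = 0
  · have := hs 1 0 u v
    simp [hv] at this ⊢
    exact this.ge
  have hu' := norm_ne_zero_iff.2 hu
  have hv' := norm_ne_zero_iff.2 hv
  have h1 := hcf (‖u‖⁻¹ • u) (‖v‖⁻¹ • v) (by simp [norm_smul, hu']) (by simp [norm_smul, hv'])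
  rw [hs] at h1
  have h2 : f u v = ‖u‖ ^ 2 * ‖v‖ ^ 2 * (‖u‖⁻¹ ^ 2 * ‖v‖⁻¹ ^ 2 * f u v) := by field_simp
  rw [h2, mul_comm c]
  exact mul_le_mul_of_nonneg_left h1 (by positivity)

/-- If the forms `k l` have no common zeros, for real second argument, then a small multiple of the
trace may be subtracted. -/
lemma exists_witness_nonneg {d s q : ℕ} (k : Fin q → Fin d × Fin s → ℂ)
    (hk : ∀ (u : Fin d → ℂ) (v : Fin s → ℝ), (∀ l, biForm (k l) u (fun b => v b) = 0) →
      u = 0 ∨ v = 0) :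
    ∃ ε > 0, ∀ ρ, SeparableMat ρ → 0 ≤ witness k ε ρ := by
  let F : (Fin d → ℂ) → (Fin s → ℂ) → ℝ := fun u v =>
    ∑ l, (Complex.normSq (biForm (k l) u v) + Complex.normSq (biForm (k l) u (star v)))
  have hF0 : ∀ u v, 0 ≤ F u v := fun u v =>
    Finset.sum_nonneg fun l _ => add_nonneg (Complex.normSq_nonneg _) (Complex.normSq_nonneg _)
  have hFs : ∀ (a b : ℝ) u v, F (a • u) (b • v) = a ^ 2 * b ^ 2 * F u v := by
    intro a b u v
    have : ∀ l w, biForm (k l) (a • u) (b • w) = (a * b : ℝ) * biForm (k l) u w := by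
      intro l w
      simp only [biForm, Finset.mul_sum, Pi.smul_apply, Complex.real_smul, Complex.ofReal_mul]
      exact Finset.sum_congr rfl fun _ _ => by ring
    simp only [F, star_smul, star_trivial, this, Complex.normSq_mul, Complex.normSq_ofReal,
      Finset.mul_sum]
    exact Finset.sum_congr rfl fun _ _ => by ring
  have hFpos : ∀ u v, u ≠ 0 → v ≠ 0 → 0 < F u v := by
    intro u v hu hv
    refine (hF0 u v).lt_of_ne' fun h0 => ?_
    have h1 := fun l => (Finset.sum_eq_zero_iff_of_nonneg fun l _ => add_nonneg
      (Complex.normSq_nonneg (biForm (k l) u v))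
      (Complex.normSq_nonneg (biForm (k l) u (star v)))).1 h0 l (Finset.mem_univ l)
    have h2 : ∀ l, biForm (k l) u v = 0 ∧ biForm (k l) u (star v) = 0 := fun l => by
      have := h1 l
      have h3 := Complex.normSq_nonneg (biForm (k l) u v)
      have h4 := Complex.normSq_nonneg (biForm (k l) u (star v))
      exact ⟨Complex.normSq_eq_zero.1 (by linarith), Complex.normSq_eq_zero.1 (by linarith)⟩
    have hre : ∀ l, biForm (k l) u (fun b => ((v b).re : ℂ)) = 0 := fun l => by
      have : biForm (k l) u (fun b => ((v b).re : ℂ)) =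
          (biForm (k l) u v + biForm (k l) u (star v)) / 2 := by
        simp only [biForm, ← Finset.sum_add_distrib, Finset.sum_div, Complex.re_eq_add_conj,
          Pi.star_apply, Complex.star_def]
        exact Finset.sum_congr rfl fun _ _ => by ring
      rw [this, (h2 l).1, (h2 l).2, add_zero, zero_div]
    have him : ∀ l, biForm (k l) u (fun b => ((v b).im : ℂ)) = 0 := fun l => by
      have : biForm (k l) u (fun b => ((v b).im : ℂ)) =
          (biForm (k l) u v - biForm (k l) u (star v)) / (2 * Complex.I) := by
        simp only [biForm, ← Finset.sum_sub_distrib, Finset.sum_div, Complex.im_eq_sub_conj,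
          Pi.star_apply, Complex.star_def]
        exact Finset.sum_congr rfl fun _ _ => by ring
      rw [this, (h2 l).1, (h2 l).2, sub_zero, zero_div]
    refine hv (funext fun b => Complex.ext ?_ ?_)
    · exact congrFun ((hk u _ hre).resolve_left hu) b
    · exact congrFun ((hk u _ him).resolve_left hu) b
  have hFc : Continuous fun w : (Fin d → ℂ) × (Fin s → ℂ) => F w.1 w.2 := by
    have hn := Complex.continuous_normSq
    have hb : ∀ l, Continuous fun w : (Fin d → ℂ) × (Fin s → ℂ) => biForm (k l) w.1 w.2 :=
      fun l => by unfold biForm; fun_prop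
    have hb' : ∀ l, Continuous fun w : (Fin d → ℂ) × (Fin s → ℂ) => biForm (k l) w.1 (star w.2) :=
      fun l => (hb l).comp (continuous_fst.prodMk continuous_snd.star)
    exact continuous_finsetSum _ fun l _ => (hn.comp (hb l)).add (hn.comp (hb' l))
  obtain ⟨c, hc, hFc'⟩ := exists_pos_mul_norm_sq_le F hFs hFpos hFc
  have hnorm : ∀ {n : ℕ} (w : Fin n → ℂ), ∑ a, Complex.normSq (w a) ≤ (n + 1) * ‖w‖ ^ 2 := by
    intro n w
    have : ∑ a, Complex.normSq (w a) ≤ ∑ _a : Fin n, ‖w‖ ^ 2 := by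
      refine Finset.sum_le_sum fun a _ => ?_
      rw [Complex.normSq_eq_norm_sq]
      exact pow_le_pow_left₀ (norm_nonneg _) (norm_le_pi_norm w a) 2
    rw [Finset.sum_const, Finset.card_univ, Fintype.card_fin, nsmul_eq_mul] at this
    nlinarith [sq_nonneg ‖w‖]
  refine ⟨c / ((d + 1) * (s + 1)), by positivity, fun ρ hρ => ?_⟩
  obtain ⟨ι, _, u, v, rfl⟩ := hρ.exists_sum_pureProduct
  rw [map_sum]
  refine Finset.sum_nonneg fun i _ => ?_
  rw [witness_pureProduct, sub_nonneg]
  refine le_trans ?_ (hFc' (u i) (v i))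
  have h0 : ∀ {n : ℕ} (w : Fin n → ℂ), 0 ≤ ∑ a, Complex.normSq (w a) := fun w =>
    Finset.sum_nonneg fun a _ => Complex.normSq_nonneg _
  have h1 := mul_le_mul (hnorm (u i)) (hnorm (v i)) (h0 _) (by positivity)
  calc _ ≤ c / ((d + 1) * (s + 1)) * (((d + 1) * ‖u i‖ ^ 2) * ((s + 1) * ‖v i‖ ^ 2)) :=
        mul_le_mul_of_nonneg_left h1 (by positivity)
    _ = _ := by field_simp

/-- Conjugation by the Kronecker product of two matrices. -/
noncomputable def conjKronecker {d s d' s' : ℕ} (G : Matrix (Fin d') (Fin d) ℂ)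
    (H : Matrix (Fin s') (Fin s) ℂ) :
    Matrix (Fin d × Fin s) (Fin d × Fin s) ℂ →ₗ[ℝ]
      Matrix (Fin d' × Fin s') (Fin d' × Fin s') ℂ where
  toFun ρ := (G ⊗ₖ H) * ρ * (G ⊗ₖ H)ᴴ
  map_add' _ _ := by rw [Matrix.mul_add, Matrix.add_mul]
  map_smul' _ _ := by simp

lemma conjKronecker_kronecker {d s d' s' : ℕ} (G : Matrix (Fin d') (Fin d) ℂ)
    (H : Matrix (Fin s') (Fin s) ℂ) (σ : Matrix (Fin d) (Fin d) ℂ) (τ : Matrix (Fin s) (Fin s) ℂ) :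
    conjKronecker G H (σ ⊗ₖ τ) = (G * σ * Gᴴ) ⊗ₖ (H * τ * Hᴴ) := by
  simp [conjKronecker, conjTranspose_kronecker, mul_kronecker_mul]

lemma conjKronecker_pureProduct {d s d' s' : ℕ} (G : Matrix (Fin d') (Fin d) ℂ)
    (H : Matrix (Fin s') (Fin s) ℂ) (u : Fin d → ℂ) (v : Fin s → ℂ) :
    conjKronecker G H (pureProduct u v) = pureProduct (G *ᵥ u) (H *ᵥ v) := by
  simp only [pureProduct, conjKronecker_kronecker, mul_vecMulVec, vecMulVec_mul, star_mulVec]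

lemma SeparableMat.conjKronecker {d s d' s' : ℕ} {ρ : Matrix (Fin d × Fin s) (Fin d × Fin s) ℂ}
    (h : SeparableMat ρ) (G : Matrix (Fin d') (Fin d) ℂ) (H : Matrix (Fin s') (Fin s) ℂ) :
    SeparableMat (conjKronecker G H ρ) := by
  obtain ⟨r, σ, τ, hσ, hτ, rfl⟩ := h
  exact ⟨r, fun i => G * σ i * Gᴴ, fun i => H * τ i * Hᴴ,
    fun i => (hσ i).mul_mul_conjTranspose_same G, fun i => (hτ i).mul_mul_conjTranspose_same H, by
      simp only [map_sum, conjKronecker_kronecker]⟩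

/-- The complex homogeneous coordinates `(1, x)` of a real point `x`. -/
noncomputable def homogCoord {a : ℕ} (x : Fin a → ℝ) (i : Fin (a + 1)) : ℂ :=
  ((Fin.cons 1 x : Fin (a + 1) → ℝ) i : ℂ)

lemma exists_mulVec_homogCoord {a : ℕ} (x₀ : Fin a → ℝ) {ε : ℝ} (hε : 0 < ε) :
    ∃ G : Matrix (Fin (a + 1)) (Fin (a + 1)) ℂ,
      ∀ x, G *ᵥ homogCoord (x₀ + ε • x) = homogCoord x := by
  have hε' : (ε : ℂ) ≠ 0 := Complex.ofReal_ne_zero.2 hε.ne'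
  refine ⟨Matrix.of (Fin.cons (Pi.single 0 1)
    fun j => Fin.cons (-(x₀ j : ℂ) / ε) (Pi.single j (ε : ℂ)⁻¹)), fun x => ?_⟩
  ext i
  cases i using Fin.cases with
  | zero => simp [homogCoord, mulVec, dotProduct, Pi.single_apply]
  | succ i =>
    simp [homogCoord, mulVec, dotProduct, Fin.sum_univ_succ, Pi.single_apply]
    field_simp
    ring

/-- A criterion for the separable cone: forms `k` without common zeros, and biquadratic moments `T`
that are positive semidefinite, with the forms in the kernel. -/
theorem not_isSpectrahedralShadow_separableMat_of_forms {a b d q : ℕ}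
    (P : Matrix (Fin d) (Fin (a + 1)) ℂ)
    (hP : ∀ x : Fin (a + 1) → ℝ,
      ∑ c, Complex.normSq ((P *ᵥ fun i => (x i : ℂ)) c) = ∑ i, x i ^ 2)
    (hG : ∀ (x₀ : Fin a → ℝ) (ε : ℝ), 0 < ε → ∃ G : Matrix (Fin d) (Fin d) ℂ,
      ∀ x, G *ᵥ (P *ᵥ homogCoord (x₀ + ε • x)) = P *ᵥ homogCoord x)
    (k : Fin q → Fin d × Fin (b + 1) → ℂ)
    (hk : ∀ (u : Fin d → ℂ) (v : Fin (b + 1) → ℝ),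
      (∀ l, biForm (k l) u (fun j => v j) = 0) → u = 0 ∨ v = 0)
    (R J : Fin q → Fin (a + 1) × Fin (b + 1) → ℝ)
    (hRJ : ∀ l s, ∑ c, k l (c, s.2) * P c s.1 = R l s + J l s * Complex.I)
    (T : Fin (a + 1) → Fin (a + 1) → Fin (b + 1) → Fin (b + 1) → ℝ)
    (hT₁ : ∀ i i' j j', T i i' j j' = T i' i j j') (hT₂ : ∀ i i' j j', T i i' j j' = T i i' j' j)
    (hT : ∀ f : Fin (a + 1) × Fin (b + 1) → ℝ, 0 ≤ ∑ s, ∑ t, f s * f t * T s.1 t.1 s.2 t.2)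
    (hR : ∀ l, ∑ s, ∑ t, R l s * R l t * T s.1 t.1 s.2 t.2 = 0)
    (hJ : ∀ l, ∑ s, ∑ t, J l s * J l t * T s.1 t.1 s.2 t.2 = 0)
    (htr : 0 < ∑ i, ∑ j, T i i j j) :
    ¬ IsSpectrahedralShadow {ρ : Matrix (Fin d × Fin (b + 1)) (Fin d × Fin (b + 1)) ℂ |
      SeparableMat ρ} := by
  obtain ⟨ε, hε, hεw⟩ := exists_witness_nonneg k hk
  let Q : Fin (a + 1) × Fin (b + 1) → Fin (a + 1) × Fin (b + 1) → ℝ := fun s t =>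
    (∑ l, 2 * (R l s * R l t + J l s * J l t)) - ε * if s = t then 1 else 0
  have hQ : ∀ W : Fin (a + 1) × Fin (b + 1) → Fin (a + 1) × Fin (b + 1) → ℝ,
      ∑ s, ∑ t, Q s t * W s t = 2 * (∑ s, ∑ t, (∑ l, R l s * R l t) * W s t +
        ∑ s, ∑ t, (∑ l, J l s * J l t) * W s t) -
          ε * ∑ s, ∑ t, (if s = t then 1 else 0) * W s t := by
    intro W
    have : ∀ s t, Q s t = 2 * (∑ l, R l s * R l t + ∑ l, J l s * J l t) -
        ε * if s = t then 1 else 0 := fun s t => by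
      rw [← Finset.sum_add_distrib, Finset.mul_sum]
    simp only [this, sub_mul, add_mul, mul_assoc, Finset.sum_sub_distrib, Finset.sum_add_distrib,
      ← Finset.mul_sum]
  have hQT : ∑ s, ∑ t, Q s t * T s.1 t.1 s.2 t.2 < 0 := by
    have h1 : ∀ A : Fin q → Fin (a + 1) × Fin (b + 1) → ℝ,
        ∑ s, ∑ t, (∑ l, A l s * A l t) * T s.1 t.1 s.2 t.2 =
          ∑ l, ∑ s, ∑ t, A l s * A l t * T s.1 t.1 s.2 t.2 := by
      intro A
      simp only [Finset.sum_mul]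
      rw [eq_comm, Finset.sum_comm]
      exact Finset.sum_congr rfl fun s _ => Finset.sum_comm
    have h3 : ∑ s : Fin (a + 1) × Fin (b + 1), ∑ t, (if s = t then 1 else 0) * T s.1 t.1 s.2 t.2 =
        ∑ i, ∑ j, T i i j j := by
      simp [Fintype.sum_prod_type]
    rw [hQ, h1, h1, h3]
    simp only [hR, hJ, Finset.sum_const_zero]
    have := mul_pos hε htr
    linarith
  refine not_isSpectrahedralShadow_of_moments
    (fun z : Fin a ⊕ Fin b → ℝ => pureProduct (P *ᵥ homogCoord fun i => z (Sum.inl i))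
      (homogCoord fun j => z (Sum.inr j)))
    (fun z => separableMat_pureProduct _ _) (biquadratic Q) (fun z₀ δ hδ => ?_)
    fun r => exists_momentPosOn_biquadratic T hT₁ hT₂ hT Q hQT _
  obtain ⟨G, hG⟩ := hG (fun i => z₀ (Sum.inl i)) δ hδ
  obtain ⟨H, hH⟩ := exists_mulVec_homogCoord (fun j => z₀ (Sum.inr j)) hδ
  refine ⟨witness k ε ∘ₗ conjKronecker G H, fun ρ hρ => hεw _ (hρ.conjKronecker G H), fun z => ?_⟩
  have hx := hG fun i => z (Sum.inl i)
  have hy := hH fun j => z (Sum.inr j)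
  rw [LinearMap.comp_apply, conjKronecker_pureProduct]
  change witness k ε (pureProduct (G *ᵥ P *ᵥ homogCoord ((fun i => z₀ (Sum.inl i)) +
    δ • fun i => z (Sum.inl i))) (H *ᵥ homogCoord ((fun i => z₀ (Sum.inr i)) +
    δ • fun i => z (Sum.inr i)))) = _
  rw [hx, hy, witness_pureProduct,
    eval_biquadratic Q z (Fin.cons 1 fun i => z (Sum.inl i)) rfl
      (Fin.cons 1 fun i => z (Sum.inr i)) rfl]
  unfold homogCoord
  generalize (Fin.cons 1 fun i => z (Sum.inl i) : Fin (a + 1) → ℝ) = x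
  generalize (Fin.cons 1 fun i => z (Sum.inr i) : Fin (b + 1) → ℝ) = y
  have hstar : (star fun j => (y j : ℂ)) = fun j => (y j : ℂ) := by
    ext j
    simp
  have hform : ∀ l, biForm (k l) (P *ᵥ fun i => (x i : ℂ)) (fun j => (y j : ℂ)) =
      ((∑ s, R l s * (x s.1 * y s.2) : ℝ) : ℂ) + ((∑ s, J l s * (x s.1 * y s.2) : ℝ) : ℂ) *
        Complex.I := by
    intro l
    have h1 : ∀ s, ((R l s * (x s.1 * y s.2) : ℝ) : ℂ) + ((J l s * (x s.1 * y s.2) : ℝ) : ℂ) *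
        Complex.I = (∑ c, k l (c, s.2) * P c s.1) * (x s.1 * y s.2) := by
      intro s
      rw [hRJ]
      push_cast
      ring
    rw [Complex.ofReal_sum, Complex.ofReal_sum, Finset.sum_mul, ← Finset.sum_add_distrib,
      Finset.sum_congr rfl fun s _ => h1 s]
    simp only [biForm, Fintype.sum_prod_type, mulVec, dotProduct, Finset.sum_mul, Finset.mul_sum]
    rw [eq_comm, Finset.sum_comm, Finset.sum_congr rfl fun j _ => Finset.sum_comm, Finset.sum_comm]
    refine Finset.sum_congr rfl fun c _ => Finset.sum_congr rfl fun j _ =>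
      Finset.sum_congr rfl fun i _ => by ring
  rw [hstar, hP]
  simp only [hform, Complex.normSq_add_mul_I, Complex.normSq_ofReal, ← pow_two]
  have h1 : ∀ A : Fin q → Fin (a + 1) × Fin (b + 1) → ℝ,
      ∑ l, (∑ s, A l s * (x s.1 * y s.2)) ^ 2 =
        ∑ s, ∑ t, (∑ l, A l s * A l t) * ((x s.1 * y s.2) * (x t.1 * y t.2)) := by
    intro A
    simp only [pow_two, Finset.sum_mul_sum]
    simp only [Finset.sum_mul]
    rw [Finset.sum_comm]
    refine Finset.sum_congr rfl fun s _ => ?_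
    rw [Finset.sum_comm]
    exact Finset.sum_congr rfl fun t _ => Finset.sum_congr rfl fun l _ => by ring
  have h3 : (∑ i, x i ^ 2) * ∑ j, y j ^ 2 = ∑ s : Fin (a + 1) × Fin (b + 1), ∑ t,
      (if s = t then 1 else 0) * ((x s.1 * y s.2) * (x t.1 * y t.2)) := by
    simp only [ite_mul, one_mul, zero_mul, Finset.sum_ite_eq, Finset.mem_univ, if_true,
      Fintype.sum_prod_type, Finset.sum_mul_sum]
    exact Finset.sum_congr rfl fun t _ => Finset.sum_congr rfl fun l _ => by ring
  rw [h3, ← Finset.sum_congr rfl fun l _ => two_mul _, ← Finset.mul_sum, Finset.sum_add_distrib,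
    h1, h1, hQ]

/-- The criterion for integral forms, with moments given as a sum of squares of integral forms. -/
theorem not_isSpectrahedralShadow_separableMat_of_int_forms {a b d q p : ℕ}
    (P : Matrix (Fin d) (Fin (a + 1)) ℂ)
    (hP : ∀ x : Fin (a + 1) → ℝ,
      ∑ c, Complex.normSq ((P *ᵥ fun i => (x i : ℂ)) c) = ∑ i, x i ^ 2)
    (hG : ∀ (x₀ : Fin a → ℝ) (ε : ℝ), 0 < ε → ∃ G : Matrix (Fin d) (Fin d) ℂ,
      ∀ x, G *ᵥ (P *ᵥ homogCoord (x₀ + ε • x)) = P *ᵥ homogCoord x)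
    (k : Fin q → Fin d → Fin (b + 1) → ℂ)
    (hk : ∀ (u : Fin d → ℂ) (v : Fin (b + 1) → ℝ),
      (∀ l, ∑ c, ∑ j, k l c j * (u c * v j) = 0) → u = 0 ∨ v = 0)
    (R J : Fin q → Fin (a + 1) → Fin (b + 1) → ℤ)
    (hRJ : ∀ l i j, ∑ c, k l c j * P c i = R l i j + J l i j * Complex.I)
    (w : Fin p → ℕ) (g : Fin p → Fin (a + 1) → Fin (b + 1) → ℤ)
    (hg : ∀ i i' j j', ∑ m, w m * (g m i j * g m i' j') = ∑ m, w m * (g m i' j * g m i j'))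
    (hR : ∀ l m, ∑ i, ∑ j, R l i j * g m i j = 0)
    (hJ : ∀ l m, ∑ i, ∑ j, J l i j * g m i j = 0)
    (htr : 0 < ∑ i, ∑ j, ∑ m, w m * (g m i j * g m i j)) :
    ¬ IsSpectrahedralShadow {ρ : Matrix (Fin d × Fin (b + 1)) (Fin d × Fin (b + 1)) ℂ |
      SeparableMat ρ} := by
  have hsos : ∀ f : Fin (a + 1) × Fin (b + 1) → ℝ, ∑ s, ∑ t, f s * f t *
      ((∑ m, w m * (g m s.1 s.2 * g m t.1 t.2) : ℤ) : ℝ) =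
        ∑ m, w m * (∑ s, f s * g m s.1 s.2) ^ 2 := by
    intro f
    simp only [pow_two, Finset.sum_mul_sum]
    push_cast
    simp only [Finset.mul_sum]
    rw [Finset.sum_comm (s := (Finset.univ : Finset (Fin p)))]
    refine Finset.sum_congr rfl fun s _ => ?_
    rw [Finset.sum_comm (s := (Finset.univ : Finset (Fin p)))]
    exact Finset.sum_congr rfl fun t _ => Finset.sum_congr rfl fun m _ => by ring
  refine not_isSpectrahedralShadow_separableMat_of_forms P hP hG (fun l t => k l t.1 t.2)
    (fun u v h => hk u v fun l => ?_) (fun l t => R l t.1 t.2) (fun l t => J l t.1 t.2)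
    (fun l s => by simpa using hRJ l s.1 s.2)
    (fun i i' j j' => (∑ m, w m * (g m i j * g m i' j') : ℤ))
    (fun i i' j j' => by rw [hg]) (fun i i' j j' => ?_)
    (fun f => ?_) (fun l => ?_) (fun l => ?_) (by exact_mod_cast htr)
  · simpa [biForm, Fintype.sum_prod_type] using h l
  · rw [hg]
    simp only [mul_comm (g _ i' j)]
  · rw [hsos]
    positivity
  · rw [hsos]
    have : ∀ m, ∑ s : Fin (a + 1) × Fin (b + 1), (R l s.1 s.2 : ℝ) * g m s.1 s.2 = 0 := fun m => by
      rw [Fintype.sum_prod_type]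
      exact_mod_cast hR l m
    simp [this]
  · rw [hsos]
    have : ∀ m, ∑ s : Fin (a + 1) × Fin (b + 1), (J l s.1 s.2 : ℝ) * g m s.1 s.2 = 0 := fun m => by
      rw [Fintype.sum_prod_type]
      exact_mod_cast hJ l m
    simp [this]

theorem not_isSpectrahedralShadow_separableMat_three_three :
    ¬ IsSpectrahedralShadow {ρ : Matrix (Fin 3 × Fin 3) (Fin 3 × Fin 3) ℂ | SeparableMat ρ} := by
  refine not_isSpectrahedralShadow_separableMat_of_int_forms (a := 2) (b := 2) (d := 3) 1
    (fun x => ?_) (fun x₀ ε hε => ?_)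
    ![![![1, 0, 0], ![0, -1, 0], ![0, 0, 0]], ![![0, 0, 0], ![0, 1, 0], ![0, 0, -1]],
      ![![0, 1, 0], ![-2, 0, 0], ![0, 0, 0]], ![![0, 0, 0], ![0, 0, 1], ![0, -2, 0]],
      ![![0, 0, -2], ![0, 0, 0], ![1, 0, 0]]] (fun u v h => ?_)
    ![![![1, 0, 0], ![0, -1, 0], ![0, 0, 0]], ![![0, 0, 0], ![0, 1, 0], ![0, 0, -1]],
      ![![0, 1, 0], ![-2, 0, 0], ![0, 0, 0]], ![![0, 0, 0], ![0, 0, 1], ![0, -2, 0]],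
      ![![0, 0, -2], ![0, 0, 0], ![1, 0, 0]]]
    0 (fun l i j => ?_) ![2, 1, 1, 1]
    ![![![1, 0, 0], ![0, 1, 0], ![0, 0, 1]], ![![0, 2, 0], ![1, 0, 0], ![0, 0, 0]],
      ![![0, 0, 0], ![0, 0, 2], ![0, 1, 0]], ![![0, 0, 1], ![0, 0, 0], ![2, 0, 0]]]
    (by decide +kernel) (by decide +kernel) (by decide +kernel) (by decide +kernel)
  · simp [Complex.normSq_ofReal, pow_two]
  · obtain ⟨G, hG⟩ := exists_mulVec_homogCoord x₀ hε
    exact ⟨G, fun x => by simpa using hG x⟩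
  · have h0 := h 0
    have h1 := h 1
    have h2 := h 2
    have h3 := h 3
    have h4 := h 4
    simp [Fin.sum_univ_three] at h0 h1 h2 h3 h4
    have hc : u 0 * v 0 = 0 := by
      refine pow_eq_zero_iff (n := 3) three_ne_zero |>.1 ?_
      linear_combination u 0 * v 0 * (u 0 * v 0 * h0 + u 1 * v 1 * (h0 + h1)) -
        (u 1 * v 2 * (u 2 * v 0) * h2 + 2 * (u 1 * v 0) * (u 2 * v 0) * h3 +
          4 * (u 1 * v 0) * (u 2 * v 1) * h4) / 7
    have hc₁ : u 1 * v 1 = 0 := by linear_combination hc - h0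
    have hc₂ : u 2 * v 2 = 0 := by linear_combination hc₁ - h1
    rw [or_iff_not_imp_right]
    intro hv
    have hu : u 0 = 0 ∧ u 1 = 0 ∧ u 2 = 0 := by
      by_cases hv₀ : v 0 = 0
      · by_cases hv₁ : v 1 = 0
        · have hv₂ : v 2 ≠ 0 := fun hv₂ => hv (funext fun i => by fin_cases i <;> assumption)
          simp_all
        · simp_all
      · simp_all
    ext i
    fin_cases i
    exacts [hu.1, hu.2.1, hu.2.2]
  · fin_cases l <;> fin_cases i <;> fin_cases j <;> simp [Matrix.one_apply]

theorem not_isSpectrahedralShadow_separableMat_two_four :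
    ¬ IsSpectrahedralShadow {ρ : Matrix (Fin 2 × Fin 4) (Fin 2 × Fin 4) ℂ | SeparableMat ρ} := by
  refine not_isSpectrahedralShadow_separableMat_of_int_forms (a := 2) (b := 3) (d := 2)
    !![1, 0, 0; 0, 1, Complex.I] (fun x => ?_) (fun x₀ ε hε => ?_)
    ![![![-Complex.I, -1, 0, 0], ![0, 1, 0, 0]], ![![0, 0, -Complex.I, 0], ![0, 0, 0, 1]],
      ![![-2 * Complex.I, 1, 1, -Complex.I], ![Complex.I, 0, 1, 0]]] (fun u v h => ?_)
    ![![![0, -1, 0, 0], ![0, 1, 0, 0], ![0, 0, 0, 0]],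
      ![![0, 0, 0, 0], ![0, 0, 0, 1], ![0, 0, 0, 0]],
      ![![0, 1, 1, 0], ![0, 0, 1, 0], ![-1, 0, 0, 0]]]
    ![![![-1, 0, 0, 0], ![0, 0, 0, 0], ![0, 1, 0, 0]],
      ![![0, 0, -1, 0], ![0, 0, 0, 0], ![0, 0, 0, 1]],
      ![![-2, 0, 0, -1], ![1, 0, 0, 0], ![0, 0, 1, 0]]]
    (fun l i j => ?_) ![2, 2, 2, 2, 1, 1]
    ![![![1, 0, 0, 0], ![1, 0, 0, 0], ![0, 1, 1, 0]],
      ![![0, 1, 0, 0], ![0, 1, 0, 0], ![1, 0, 0, 0]],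
      ![![0, 0, 1, 0], ![0, 0, 0, 0], ![1, 0, 0, 1]],
      ![![0, 0, 0, 1], ![0, 0, 0, 0], ![0, 0, 1, 0]],
      ![![0, 0, 0, 0], ![1, 0, 0, 0], ![0, 0, -1, 0]],
      ![![0, 0, 0, 0], ![0, 0, 1, 0], ![1, 0, 0, 0]]]
    (by decide +kernel) (by decide +kernel) (by decide +kernel) (by decide +kernel)
  · simp [Fin.sum_univ_three, Fin.sum_univ_two, mulVec, dotProduct, Complex.normSq_apply, pow_two]
    ring
  · have hε' : (ε : ℂ) ≠ 0 := Complex.ofReal_ne_zero.2 hε.ne'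
    refine ⟨!![1, 0; -(x₀ 0 + x₀ 1 * Complex.I) / ε, (ε : ℂ)⁻¹], fun x => ?_⟩
    ext i
    fin_cases i
    · simp [mulVec, dotProduct, Fin.sum_univ_three, Fin.sum_univ_two, homogCoord]
    · have h2 : ∀ y : Fin 2 → ℝ, (Fin.cons 1 y : Fin 3 → ℝ) 2 = y 1 := fun y => rfl
      simp [mulVec, dotProduct, Fin.sum_univ_three, Fin.sum_univ_two, homogCoord, h2]
      field_simp
      ring
  · have h0 := h 0
    have h1 := h 1
    have h2 := h 2
    simp [Fin.sum_univ_two, Fin.sum_univ_four] at h0 h1 h2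
    by_cases hu : u 0 = 0
    · simp only [hu, zero_mul, mul_zero, neg_zero, zero_add] at h0 h1 h2
      by_cases hu₁ : u 1 = 0
      · refine Or.inl (funext fun i => ?_)
        fin_cases i <;> assumption
      · have hv : Complex.I * v 0 + v 2 = 0 := mul_left_cancel₀ hu₁ (by linear_combination h2)
        have hre := congrArg Complex.re hv
        have him := congrArg Complex.im hv
        simp at hre him
        simp [hu₁] at h0 h1
        refine Or.inr (funext fun i => ?_)
        fin_cases i <;> assumption
    · obtain ⟨z, hz⟩ : ∃ z, u 1 = u 0 * z := ⟨u 1 / u 0, by field_simp⟩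
      rw [hz] at h0 h1 h2
      replace h0 : -(Complex.I * v 0) - v 1 + z * v 1 = 0 :=
        mul_left_cancel₀ hu (by linear_combination h0)
      replace h1 : -(Complex.I * v 2) + z * v 3 = 0 :=
        mul_left_cancel₀ hu (by linear_combination h1)
      replace h2 : -(2 * Complex.I * v 0) + v 1 + v 2 - Complex.I * v 3 + Complex.I * z * v 0 +
          z * v 2 = 0 :=
        mul_left_cancel₀ hu (by linear_combination h2)
      have hre0 := congrArg Complex.re h0
      have him0 := congrArg Complex.im h0
      have hre1 := congrArg Complex.re h1
      have him1 := congrArg Complex.im h1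
      have hre2 := congrArg Complex.re h2
      have him2 := congrArg Complex.im h2
      simp at hre0 him0 hre1 him1 hre2 him2
      have hv₁ : v 1 = 0 := by
        by_contra hv₁
        have hz₁ : z.re = 1 := mul_right_cancel₀ hv₁ (by linear_combination hre0)
        have hv₃ : v 3 = 0 := by simpa [hz₁] using hre1
        have hv₂ : v 2 = 0 := by simpa [hv₃] using him1
        have hv₀ : v 0 = 0 := by
          rw [hz₁, hv₂, hv₃] at him2
          linarith
        rw [hv₀, hv₂] at hre2
        exact hv₁ (by linarith)
      have hv₀ : v 0 = 0 := by simpa [hv₁] using him0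
      have hv₃ : v 3 = 0 := by
        rcases hre1 with hz₀ | hv₃
        · have hv₂ : v 2 = 0 := by simpa [hv₀, hv₁, hz₀] using hre2
          rw [hv₀, hv₂] at him2
          linarith
        · exact hv₃
      have hv₂ : v 2 = 0 := by simpa [hv₃] using him1
      refine Or.inr (funext fun i => ?_)
      fin_cases i <;> assumption
  · fin_cases l <;> fin_cases i <;> fin_cases j <;> simp [Fin.sum_univ_two]

lemma image_conjKronecker_setOf_separableMat {d s d' s' : ℕ} {G : Matrix (Fin d') (Fin d) ℂ}
    {H : Matrix (Fin s') (Fin s) ℂ} {E : Matrix (Fin d) (Fin d') ℂ} {F : Matrix (Fin s) (Fin s') ℂ}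
    (hGE : G * E = 1) (hHF : H * F = 1) :
    conjKronecker G H '' {ρ | SeparableMat ρ} = {ρ | SeparableMat ρ} := by
  ext ρ
  constructor
  · rintro ⟨ρ, hρ, rfl⟩
    exact hρ.conjKronecker G H
  · refine fun hρ => ⟨conjKronecker E F ρ, hρ.conjKronecker E F, ?_⟩
    have h : (G ⊗ₖ H) * (E ⊗ₖ F) = 1 := by
      rw [← Matrix.mul_kronecker_mul, hGE, hHF, Matrix.one_kronecker_one]
    change (G ⊗ₖ H) * ((E ⊗ₖ F) * ρ * (E ⊗ₖ F)ᴴ) * (G ⊗ₖ H)ᴴ = ρ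
    calc _ = ((G ⊗ₖ H) * (E ⊗ₖ F)) * ρ * ((G ⊗ₖ H) * (E ⊗ₖ F))ᴴ := by
          simp only [Matrix.conjTranspose_mul, Matrix.mul_assoc]
      _ = ρ := by simp [h]

lemma exists_mul_eq_one_of_le {m n : ℕ} (h : m ≤ n) :
    ∃ (G : Matrix (Fin m) (Fin n) ℂ) (E : Matrix (Fin n) (Fin m) ℂ), G * E = 1 := by
  refine ⟨(1 : Matrix (Fin n) (Fin n) ℂ).submatrix (Fin.castLE h) id,
    (1 : Matrix (Fin n) (Fin n) ℂ).submatrix id (Fin.castLE h), ?_⟩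
  rw [← Matrix.submatrix_mul _ _ _ _ _ Function.bijective_id, Matrix.one_mul]
  exact Matrix.submatrix_one _ (Fin.castLE_injective h)

lemma IsSpectrahedralShadow.separableMat_of_le {d s d' s' : ℕ} (hd : d' ≤ d) (hs : s' ≤ s)
    (h : IsSpectrahedralShadow {ρ : Matrix (Fin d × Fin s) (Fin d × Fin s) ℂ | SeparableMat ρ}) :
    IsSpectrahedralShadow
      {ρ : Matrix (Fin d' × Fin s') (Fin d' × Fin s') ℂ | SeparableMat ρ} := by
  obtain ⟨G, E, hGE⟩ := exists_mul_eq_one_of_le hd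
  obtain ⟨H, F, hHF⟩ := exists_mul_eq_one_of_le hs
  rw [← image_conjKronecker_setOf_separableMat hGE hHF]
  exact h.image _

/-- Exchange of the two tensor factors. -/
def swapKronecker (d s : ℕ) : Matrix (Fin d × Fin s) (Fin d × Fin s) ℂ →ₗ[ℝ]
    Matrix (Fin s × Fin d) (Fin s × Fin d) ℂ where
  toFun ρ := ρ.submatrix Prod.swap Prod.swap
  map_add' _ _ := rfl
  map_smul' _ _ := rfl

lemma SeparableMat.swapKronecker {d s : ℕ} {ρ : Matrix (Fin d × Fin s) (Fin d × Fin s) ℂ}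
    (h : SeparableMat ρ) : SeparableMat (swapKronecker d s ρ) := by
  obtain ⟨r, σ, τ, hσ, hτ, rfl⟩ := h
  refine ⟨r, τ, σ, hτ, hσ, ?_⟩
  rw [map_sum]
  refine Finset.sum_congr rfl fun i _ => ?_
  ext s t
  exact mul_comm _ _

lemma IsSpectrahedralShadow.separableMat_swap {d s : ℕ}
    (h : IsSpectrahedralShadow {ρ : Matrix (Fin d × Fin s) (Fin d × Fin s) ℂ | SeparableMat ρ}) :
    IsSpectrahedralShadow {ρ : Matrix (Fin s × Fin d) (Fin s × Fin d) ℂ | SeparableMat ρ} := by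
  convert h.image (swapKronecker d s)
  ext ρ
  constructor
  · exact fun hρ => ⟨swapKronecker s d ρ, hρ.swapKronecker, rfl⟩
  · rintro ⟨ρ, hρ, rfl⟩
    exact hρ.swapKronecker

/-- For `d, s ≥ 2` with `d + s > 5`, the cone of separable positive semidefinite matrices
(equivalently, under the Choi correspondence, the cone of entanglement-breaking maps)
is not a spectrahedral shadow. -/
theorem sep_cone_not_spectrahedral_shadow (d s : ℕ) (hd : 2 ≤ d) (hs : 2 ≤ s)
    (hds : 5 < d + s) :
    ¬ IsSpectrahedralShadow {ρ : Matrix (Fin d × Fin s) (Fin d × Fin s) ℂ |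
        SeparableMat ρ} := by
  intro h
  obtain ⟨h₁, h₂⟩ | h₂ | h₁ : (3 ≤ d ∧ 3 ≤ s) ∨ 4 ≤ s ∨ 4 ≤ d := by omega
  · exact not_isSpectrahedralShadow_separableMat_three_three (h.separableMat_of_le h₁ h₂)
  · exact not_isSpectrahedralShadow_separableMat_two_four (h.separableMat_of_le hd h₂)
  · exact not_isSpectrahedralShadow_separableMat_two_four
      (h.separableMat_swap.separableMat_of_le hs h₁)
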